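/- arXiv:1605.09055 — 2 statements merged into one kernel-verified Lean document; each statement's English description precedes it below -/
import Mathlib

section
/- For every integer k ≥ 2 there exists δ_k > 0 such that the following holds: if G is a simple graph on n vertices with exactly ⌊n²/4⌋ + 1 edges that contains at most δ_k·n³ triangles, then at least 0.236·n² edges of G occur in C_{2k+1}. -/
open SimpleGraph

/-- An edge `e` of `G` occurs in `C_m`: `G` contains a cycle of length `m`
whose edge set contains `e`. -/
def occursInC {V : Type*} (G : SimpleGraph V) (m : ℕ) (e : Sym2 V) : Prop :=
  ∃ (u : V) (w : G.Walk u u), w.IsCycle ∧ w.length = m ∧ e ∈ w.edges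

/-- The number of edges of `G` that occur in a cycle of length `m`. -/
noncomputable def countEdgesInC {V : Type*} (G : SimpleGraph V) (m : ℕ) : ℕ :=
  {e | e ∈ G.edgeSet ∧ occursInC G m e}.ncard

/-- The number of triangles of `G`: the number of 3-element vertex subsets
spanning a triangle. -/
noncomputable def triangleCount {V : Type*} (G : SimpleGraph V) : ℕ :=
  {t : Finset V | G.IsNClique 3 t}.ncard

section Helpers

variable {V : Type*}

theorem path_lemma [DecidableEq V] (G : SimpleGraph V) [DecidableRel G.Adj]
    (P Q : Finset V) (r s : ℝ) (x : V)
    (hP : ∀ p ∈ P, (Q.card : ℝ) - r ≤ (Q.filter (G.Adj p)).card)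
    (hQ : ∀ q ∈ Q, (P.card : ℝ) - r ≤ (P.filter (G.Adj q)).card)
    (hx : r + s ≤ (Q.filter (G.Adj x)).card)
    (hsQ : r + s ≤ Q.card) (hsP : r + s ≤ P.card) :
    ∀ (j : ℕ) (F : Finset V) (p : V), p ∈ P → p ≠ x → p ∉ F → x ∉ F →
      (F.card : ℝ) + 2 * j + 2 ≤ s →
      ∃ w : G.Walk p x, w.IsPath ∧ w.length = 2 * (j + 1) ∧ ∀ z ∈ w.support, z ∉ F := by
  intro j
  induction j with
  | zero =>
    intro F p hp hpx hpF hxF hs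
    have h1 := Finset.card_union_add_card_inter (Q.filter (G.Adj p)) (Q.filter (G.Adj x))
    have h2 : (Q.filter (G.Adj p) ∪ Q.filter (G.Adj x)).card ≤ Q.card :=
      Finset.card_le_card (Finset.union_subset (Finset.filter_subset _ _) (Finset.filter_subset _ _))
    have h3 := hP p hp
    have h4 : F.card < (Q.filter (G.Adj p) ∩ Q.filter (G.Adj x)).card := by
      have h1' : (((Q.filter (G.Adj p) ∪ Q.filter (G.Adj x)).card : ℕ) : ℝ)
        + ((Q.filter (G.Adj p) ∩ Q.filter (G.Adj x)).card : ℕ) = (Q.filter (G.Adj p)).card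
          + (Q.filter (G.Adj x)).card := by exact_mod_cast h1
      have h2' : (((Q.filter (G.Adj p) ∪ Q.filter (G.Adj x)).card : ℕ) : ℝ) ≤ Q.card := by
        exact_mod_cast h2
      have : (F.card : ℝ) < (Q.filter (G.Adj p) ∩ Q.filter (G.Adj x)).card := by
        push_cast at hs
        linarith
      exact_mod_cast this
    obtain ⟨q, hq, hqF⟩ := Finset.exists_mem_notMem_of_card_lt_card h4
    simp only [Finset.mem_inter, Finset.mem_filter] at hq
    have hpq : G.Adj p q := hq.1.2
    have hqx : G.Adj q x := hq.2.2.symm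
    refine ⟨.cons hpq (.cons hqx .nil), ?_, by simp, ?_⟩
    · simp [hpq.ne, hqx.ne, hpx]
    · simp [hpF, hqF, hxF]
  | succ j ih =>
    intro F p hp hpx hpF hxF hs
    push_cast at hs
    have h1 : (insert x F).card < (Q.filter (G.Adj p)).card := by
      have h3 := hP p hp
      have h4 : ((insert x F).card : ℝ) ≤ F.card + 1 := by exact_mod_cast Finset.card_insert_le _ _
      have hj : (0 : ℝ) ≤ j := Nat.cast_nonneg j
      have : ((insert x F).card : ℝ) < (Q.filter (G.Adj p)).card := by linarith
      exact_mod_cast this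
    obtain ⟨q, hq, hqF⟩ := Finset.exists_mem_notMem_of_card_lt_card h1
    simp only [Finset.mem_filter, Finset.mem_insert, not_or] at hq hqF
    have h1 : (insert p (insert x F)).card < (P.filter (G.Adj q)).card := by
      have h3 := hQ q hq.1
      have h4 : ((insert x F).card : ℝ) ≤ F.card + 1 := by exact_mod_cast Finset.card_insert_le _ _
      have h5 : ((insert p (insert x F)).card : ℝ) ≤ (insert x F).card + 1 := by
        exact_mod_cast Finset.card_insert_le _ _
      have hj : (0 : ℝ) ≤ j := Nat.cast_nonneg j
      have : ((insert p (insert x F)).card : ℝ) < (P.filter (G.Adj q)).card := by linarith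
      exact_mod_cast this
    obtain ⟨p', hp', hpF'⟩ := Finset.exists_mem_notMem_of_card_lt_card h1
    simp only [Finset.mem_filter, Finset.mem_insert, not_or] at hp' hpF'
    obtain ⟨w, hw, hl, hsup⟩ := ih (insert p (insert q F)) p' hp'.1 hpF'.2.1
      (by simp [hpF'.1, hpF'.2.2, hp'.2.ne'])
      (by simp [hpx.symm, Ne.symm hqF.1, hxF])
      (by
        have h4 : ((insert q F).card : ℝ) ≤ F.card + 1 := by
          exact_mod_cast Finset.card_insert_le _ _
        have h5 : ((insert p (insert q F)).card : ℝ) ≤ (insert q F).card + 1 := by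
          exact_mod_cast Finset.card_insert_le _ _
        linarith)
    have hps : p ∉ w.support := fun h => by simpa using hsup p h
    have hqs : q ∉ w.support := fun h => by simpa using hsup q h
    refine ⟨.cons hq.2 (.cons hp'.2 w), ?_, ?_, ?_⟩
    · simp [hw, hps, hqs, hq.2.ne]
    · simp [hl]; ring
    · intro z hz
      simp only [Walk.support_cons, List.mem_cons] at hz
      rcases hz with rfl | rfl | hz
      · exact hpF
      · exact hqF.2
      · intro hF
        exact hsup z hz (by simp [hF])

theorem occurs_lemma [DecidableEq V] (G : SimpleGraph V) [DecidableRel G.Adj]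
    (P Q : Finset V) (r s : ℝ) (x : V) (k : ℕ) (hk : 2 ≤ k)
    (hP : ∀ p ∈ P, (Q.card : ℝ) - r ≤ (Q.filter (G.Adj p)).card)
    (hQ : ∀ q ∈ Q, (P.card : ℝ) - r ≤ (P.filter (G.Adj q)).card)
    (hx : r + s ≤ (Q.filter (G.Adj x)).card)
    (hsQ : r + s ≤ Q.card) (hsP : r + s ≤ P.card) (hs : 2 * (k : ℝ) ≤ s)
    (p q y : V) (hp : p ∈ P) (hpq : G.Adj q p) (hyq : G.Adj y q) (hxy : G.Adj x y)
    (hpx : p ≠ x) (hpy : p ≠ y) (hqx : q ≠ x) :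
    occursInC G (2 * k + 1) s(p, q) := by
  obtain ⟨j, rfl⟩ := Nat.exists_eq_add_of_le' hk
  obtain ⟨w, hw, hl, hsup⟩ := path_lemma G P Q r s x hP hQ hx hsQ hsP j {y, q} p hp hpx
    (by simp [hpy, hpq.ne']) (by simp [hxy.ne, hqx.symm])
    (by
      have h : (({y, q} : Finset V).card : ℝ) ≤ 2 := by exact_mod_cast Finset.card_le_two
      push_cast at hs
      linarith)
  have hys : y ∉ w.support := fun h => by simpa using hsup y h
  have hqs : q ∉ w.support := fun h => by simpa using hsup q h
  refine ⟨x, .cons hxy (.cons hyq (.cons hpq w)), ?_, ?_, ?_⟩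
  · rw [Walk.cons_isCycle_iff]
    refine ⟨by simp [hw, hqs, hys, hyq.ne], ?_⟩
    simp only [Walk.edges_cons, List.mem_cons, not_or]
    refine ⟨?_, ?_, ?_⟩
    · intro h
      rw [Sym2.eq_iff] at h
      rcases h with h | h
      · exact hxy.ne h.1
      · exact hqx h.1.symm
    · intro h
      rw [Sym2.eq_iff] at h
      rcases h with h | h
      · exact hpy h.2.symm
      · exact hyq.ne h.2
    · intro h
      exact hys (Walk.snd_mem_support_of_mem_edges w h)
  · simp [hl]; ring
  · simp [Sym2.eq_swap]

theorem count_lemma [Fintype V] [DecidableEq V] (G : SimpleGraph V) [DecidableRel G.Adj]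
    (P Q : Finset V) (hd : Disjoint P Q) (m : ℕ) (a b : ℝ) (hb : 0 ≤ b) (Q' : Finset V)
    (hQ' : Q' ⊆ Q) (hca : a ≤ Q'.card)
    (h : ∀ q ∈ Q', ∃ P' : Finset V, P' ⊆ P ∧ b ≤ P'.card ∧
      ∀ p ∈ P', G.Adj q p ∧ occursInC G m s(p, q)) :
    a * b ≤ countEdgesInC G m := by
  classical
  choose! f hf1 hf2 hf3 using h
  have hcard : (Q'.sigma f).card ≤ countEdgesInC G m := by
    unfold countEdgesInC
    rw [← Set.ncard_coe_finset]
    refine Set.ncard_le_ncard_of_injOn (fun z => s(z.2, z.1)) ?_ ?_ (Set.toFinite _)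
    · rintro ⟨q, p⟩ hz
      simp only [Finset.mem_coe, Finset.mem_sigma] at hz
      exact ⟨(hf3 q hz.1 p hz.2).1.symm, (hf3 q hz.1 p hz.2).2⟩
    · rintro ⟨q, p⟩ hz ⟨q', p'⟩ hz' he
      simp only [Finset.mem_coe, Finset.mem_sigma] at hz hz'
      simp only [Sym2.eq_iff] at he
      rcases he with ⟨h1, h2⟩ | ⟨h1, h2⟩
      · subst h1; subst h2; rfl
      · exfalso
        have := hf1 q hz.1 hz.2
        have h3 := hQ' hz'.1
        rw [← h1] at h3
        exact Finset.disjoint_left.mp hd this h3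
  have h1 : (Q'.card : ℝ) * b ≤ (Q'.sigma f).card := by
    rw [Finset.card_sigma]
    push_cast
    calc (Q'.card : ℝ) * b = ∑ q ∈ Q', b := by simp
      _ ≤ _ := Finset.sum_le_sum hf2
  calc a * b ≤ Q'.card * b := by gcongr
    _ ≤ _ := h1
    _ ≤ _ := by exact_mod_cast hcard

/-- Neighbours of `v` inside `U`. -/
def nbs (G : SimpleGraph V) [DecidableRel G.Adj] (U : Finset V) (v : V) : Finset V :=
  U.filter (G.Adj v)

/-- Common neighbours inside `U`. -/
def cod [DecidableEq V] (G : SimpleGraph V) [DecidableRel G.Adj] (U : Finset V) (a b : V) :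
    Finset V := nbs G U a ∩ nbs G U b

/-- Twice the number of triangles at `a`. -/
def tri [DecidableEq V] (G : SimpleGraph V) [DecidableRel G.Adj] (U : Finset V) (a : V) : ℕ :=
  ∑ b ∈ nbs G U a, (cod G U a b).card

/-- Number of ordered triangles in `U`. -/
def tau [DecidableEq V] (G : SimpleGraph V) [DecidableRel G.Adj] (U : Finset V) : ℕ :=
  ∑ a ∈ U, tri G U a

/-- Twice the number of edges in `U`. -/
def dsum (G : SimpleGraph V) [DecidableRel G.Adj] (U : Finset V) : ℕ :=
  ∑ a ∈ U, (nbs G U a).card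

/-- Typical neighbours of `u`. -/
def typ [DecidableEq V] (G : SimpleGraph V) [DecidableRel G.Adj] (U : Finset V) (u v : V)
    (r : ℕ) : Finset V :=
  (nbs G U u).filter (fun a => (cod G U u a).card ≤ r ∧ ¬ G.Adj v a)

variable [DecidableEq V] (G : SimpleGraph V) [DecidableRel G.Adj] (U : Finset V)

theorem nbs_sub (v : V) : nbs G U v ⊆ U := Finset.filter_subset _ _

theorem typ_card (u v : V) (r : ℕ) :
    (r + 1) * (nbs G U u).card ≤
      (r + 1) * (typ G U u v r).card + (r + 1) * (cod G U u v).card + tri G U u := by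
  have h1 : (nbs G U u) ⊆ typ G U u v r ∪ cod G U u v ∪
      (nbs G U u).filter (fun a => r + 1 ≤ (cod G U u a).card) := by
    intro a ha
    rw [Finset.mem_union, Finset.mem_union]
    by_cases h : G.Adj v a
    · left; right
      exact Finset.mem_inter.mpr ⟨ha, Finset.mem_filter.mpr ⟨nbs_sub G U u ha, h⟩⟩
    · rcases Nat.lt_or_ge r (cod G U u a).card with h' | h'
      · right; exact Finset.mem_filter.mpr ⟨ha, h'⟩
      · left; left; exact Finset.mem_filter.mpr ⟨ha, h', h⟩
  have h2 := Finset.card_le_card h1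
  have h3 := Finset.card_union_le (typ G U u v r ∪ cod G U u v)
    ((nbs G U u).filter (fun a => r + 1 ≤ (cod G U u a).card))
  have h4 := Finset.card_union_le (typ G U u v r) (cod G U u v)
  have h5 : (r + 1) * ((nbs G U u).filter (fun a => r + 1 ≤ (cod G U u a).card)).card
      ≤ tri G U u := by
    unfold tri
    calc _ = ∑ a ∈ (nbs G U u).filter (fun a => r + 1 ≤ (cod G U u a).card), (r + 1) := by
          simp [mul_comm]
      _ ≤ ∑ a ∈ (nbs G U u).filter (fun a => r + 1 ≤ (cod G U u a).card), (cod G U u a).card := by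
          apply Finset.sum_le_sum
          intro a ha
          exact (Finset.mem_filter.mp ha).2
      _ ≤ _ := Finset.sum_le_sum_of_subset (Finset.filter_subset _ _)
  nlinarith

theorem typ_disj (u v : V) (r r' : ℕ) : Disjoint (typ G U u v r) (typ G U v u r') := by
  rw [Finset.disjoint_left]
  intro a ha hb
  simp only [typ, nbs, Finset.mem_filter] at ha hb
  exact ha.2.2 hb.1.2

theorem typ_adj (u v : V) (r r' : ℕ) (a : V) (ha : a ∈ typ G U u v r) :
    (typ G U v u r').card + (nbs G U u).card + (nbs G U a).card ≤
      ((typ G U v u r').filter (G.Adj a)).card + U.card + r := by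
  set B := typ G U v u r'
  have ha' : (cod G U u a).card ≤ r := (Finset.mem_filter.mp ha).2.1
  have h1 : nbs G U u ∪ nbs G U a ∪ B.filter (fun b => ¬ G.Adj a b) ⊆ U := by
    intro z hz
    simp only [B, typ, nbs, Finset.mem_union, Finset.mem_filter] at hz
    tauto
  have h2 := Finset.card_le_card h1
  have h3 : Disjoint (nbs G U u ∪ nbs G U a) (B.filter (fun b => ¬ G.Adj a b)) := by
    rw [Finset.disjoint_left]
    intro z hz hz'
    simp only [B, typ, nbs, Finset.mem_union, Finset.mem_filter] at hz hz'
    tauto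
  rw [Finset.card_union_of_disjoint h3] at h2
  have h4 := Finset.card_union_add_card_inter (nbs G U u) (nbs G U a)
  have h5 : (nbs G U u ∩ nbs G U a).card ≤ r := ha'
  have h6 := Finset.card_filter_add_card_filter_not (s := B) (G.Adj a)
  omega

theorem good_dart (K : ℕ) (h : 3 * U.card * tau G U < K * dsum G U) :
    ∃ u ∈ U, ∃ v ∈ U, G.Adj u v ∧
      tri G U u + tri G U v + U.card * (cod G U u v).card ≤ K := by
  by_contra! hc
  have h1 : K * dsum G U ≤ ∑ a ∈ U, ∑ b ∈ nbs G U a,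
      (tri G U a + tri G U b + U.card * (cod G U a b).card) := by
    unfold dsum
    rw [Finset.mul_sum]
    apply Finset.sum_le_sum
    intro a ha
    rw [mul_comm, ← smul_eq_mul]
    apply Finset.card_nsmul_le_sum
    intro b hb
    have := Finset.mem_filter.mp hb
    exact (hc a ha b this.1 this.2).le
  have h2 : ∑ a ∈ U, ∑ b ∈ nbs G U a,
      (tri G U a + tri G U b + U.card * (cod G U a b).card) ≤
      ∑ a ∈ U, (U.card * tri G U a + tau G U + U.card * tri G U a) := by
    apply Finset.sum_le_sum
    intro a ha
    rw [Finset.sum_add_distrib, Finset.sum_add_distrib, Finset.sum_const, ← Finset.mul_sum,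
      smul_eq_mul]
    have h3 : (nbs G U a).card ≤ U.card := Finset.card_le_card (nbs_sub G U a)
    have h4 : ∑ b ∈ nbs G U a, tri G U b ≤ tau G U :=
      Finset.sum_le_sum_of_subset (nbs_sub G U a)
    have h5 : ∑ b ∈ nbs G U a, (cod G U a b).card = tri G U a := rfl
    rw [h5]
    gcongr
  have h3 : ∑ a ∈ U, (U.card * tri G U a + tau G U + U.card * tri G U a)
      = 3 * U.card * tau G U := by
    rw [Finset.sum_add_distrib, Finset.sum_add_distrib, ← Finset.mul_sum]
    simp only [Finset.sum_const, smul_eq_mul]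
    change U.card * tau G U + U.card * tau G U + U.card * tau G U = _
    ring
  omega

theorem mantel_tau : 2 * dsum G U ^ 2 ≤ U.card * tau G U + U.card ^ 2 * dsum G U := by
  have h1 : ∀ a b : V, (nbs G U a).card + (nbs G U b).card ≤ (cod G U a b).card + U.card := by
    intro a b
    have h := Finset.card_union_add_card_inter (nbs G U a) (nbs G U b)
    have h' : (nbs G U a ∪ nbs G U b).card ≤ U.card :=
      Finset.card_le_card (Finset.union_subset (nbs_sub G U a) (nbs_sub G U b))
    have h'' : (nbs G U a ∩ nbs G U b).card = (cod G U a b).card := rfl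
    omega
  have h2 : ∑ a ∈ U, ∑ b ∈ nbs G U a, ((nbs G U a).card + (nbs G U b).card) ≤
      ∑ a ∈ U, ∑ b ∈ nbs G U a, ((cod G U a b).card + U.card) :=
    Finset.sum_le_sum fun a _ => Finset.sum_le_sum fun b _ => h1 a b
  simp only [Finset.sum_add_distrib, Finset.sum_const, smul_eq_mul] at h2
  have h3 : ∑ a ∈ U, ∑ b ∈ nbs G U a, (cod G U a b).card = tau G U := rfl
  have h4 : ∑ a ∈ U, (nbs G U a).card * U.card = dsum G U * U.card := by
    rw [← Finset.sum_mul]; rfl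
  have h5 : ∑ a ∈ U, ∑ b ∈ nbs G U a, (nbs G U b).card
      = ∑ a ∈ U, (nbs G U a).card * (nbs G U a).card := by
    have : ∀ a, ∑ b ∈ nbs G U a, (nbs G U b).card
        = ∑ b ∈ U, if G.Adj a b then (nbs G U b).card else 0 := by
      intro a
      rw [nbs, Finset.sum_filter]
    simp only [this]
    rw [Finset.sum_comm]
    apply Finset.sum_congr rfl
    intro b _
    rw [← Finset.sum_filter, Finset.sum_const, smul_eq_mul]
    congr 2
    unfold nbs
    ext z
    simp [G.adj_comm]
  rw [h3, h4, h5] at h2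
  have h6 : dsum G U ^ 2 ≤ U.card * ∑ a ∈ U, (nbs G U a).card ^ 2 := sq_sum_le_card_mul_sum_sq
  simp only [pow_two] at h6 ⊢
  nlinarith

theorem tau_le [Fintype V] : tau G U ≤ 27 * triangleCount G := by
  have h1 : triangleCount G = (G.cliqueFinset 3).card := by
    unfold triangleCount
    rw [← Set.ncard_coe_finset]
    congr 1
    ext t
    simp
  rw [h1]
  have h2 : tau G U = (U.sigma fun a => (nbs G U a).sigma fun b => cod G U a b).card := by
    simp only [Finset.card_sigma]; rfl
  rw [h2]
  apply Finset.card_le_mul_card_image_of_maps_to (f := fun z => ({z.1, z.2.1, z.2.2} : Finset V))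
  · rintro ⟨a, b, c⟩ hz
    simp only [Finset.mem_sigma, cod, nbs, Finset.mem_inter, Finset.mem_filter] at hz
    rw [mem_cliqueFinset_iff, is3Clique_triple_iff]
    tauto
  · intro t ht
    have ht3 : t.card = 3 := (mem_cliqueFinset_iff.mp ht).card_eq
    have : (t ×ˢ (t ×ˢ t)).card = 27 := by simp [ht3]
    rw [← this]
    apply Finset.card_le_card_of_injOn (fun z => (z.1, z.2.1, z.2.2))
    · rintro ⟨a, b, c⟩ hz
      simp only [Finset.coe_filter, Set.mem_ofPred_eq] at hz
      simp [← hz.2]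
    · rintro ⟨a, b, c⟩ _ ⟨a', b', c'⟩ _ h
      simp only [Prod.mk.injEq] at h
      obtain ⟨rfl, rfl, rfl⟩ := h
      rfl

theorem card_sdiff_ge (S F : Finset V) (c : ℝ) (hF : (F.card : ℝ) ≤ c) :
    (S.card : ℝ) - c ≤ (S \ F).card := by
  have := Finset.card_sdiff_add_card S F
  have h2 := Finset.card_le_card (Finset.subset_union_left (s₁ := S) (s₂ := F))
  have : (S.card : ℝ) ≤ (S \ F).card + F.card := by exact_mod_cast by omega
  linarith

theorem fin_one [Fintype V] (P Q : Finset V) (hd : Disjoint P Q) (k : ℕ) (hk : 2 ≤ k) (u : ℝ)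
    (hu : 1000000 * ((k : ℝ) + 1) ≤ u)
    (hPc : (1 / 2 - 3 / 10000) * u ≤ P.card) (hQc : (1 / 2 - 3 / 10000) * u ≤ Q.card)
    (hP : ∀ p ∈ P, (Q.card : ℝ) - 3 / 10000 * u ≤ (Q.filter (G.Adj p)).card)
    (hQ : ∀ q ∈ Q, (P.card : ℝ) - 3 / 10000 * u ≤ (P.filter (G.Adj q)).card)
    (x y : V) (hxy : G.Adj x y)
    (hx : (1 / 2 - 17 / 10000) * u ≤ (Q.filter (G.Adj x)).card)
    (hy : (1 / 2 - 17 / 10000) * u ≤ (Q.filter (G.Adj y)).card) :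
    0.24 * u ^ 2 ≤ countEdgesInC G (2 * k + 1) := by
  have hk0 : (2 : ℝ) ≤ k := by exact_mod_cast hk
  have hc := count_lemma G P Q hd (2 * k + 1) (0.495 * u) (0.495 * u) (by nlinarith)
    (Q.filter (G.Adj y) \ {x}) (Finset.sdiff_subset.trans (Finset.filter_subset _ _))
    (by
      have := card_sdiff_ge (Q.filter (G.Adj y)) {x} 1 (by simp)
      linarith)
    (by
      intro q hq
      simp only [Finset.mem_sdiff, Finset.mem_filter, Finset.mem_singleton] at hq
      refine ⟨P.filter (G.Adj q) \ {x, y}, Finset.sdiff_subset.trans (Finset.filter_subset _ _),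
        ?_, ?_⟩
      · have := card_sdiff_ge (P.filter (G.Adj q)) {x, y} 2
          (by exact_mod_cast Finset.card_le_two)
        have := hQ q hq.1.1
        linarith
      · intro p hp
        simp only [Finset.mem_sdiff, Finset.mem_filter, Finset.mem_insert, Finset.mem_singleton,
          not_or] at hp
        exact ⟨hp.1.2, occurs_lemma G P Q (3 / 10000 * u) (2 * k) x k hk hP hQ (by linarith)
          (by linarith) (by linarith) le_rfl p q y hp.1.1 hp.1.2 hq.1.2 hxy hp.2.1 hp.2.2 hq.2⟩)
  nlinarith [sq_nonneg u]

theorem fin_two [Fintype V] (P Q : Finset V) (hd : Disjoint P Q) (k : ℕ) (hk : 2 ≤ k) (u : ℝ)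
    (hu : 1000000 * ((k : ℝ) + 1) ≤ u)
    (hPc : (1 / 2 - 3 / 10000) * u ≤ P.card) (hQc : (1 / 2 - 3 / 10000) * u ≤ Q.card)
    (hP : ∀ p ∈ P, (Q.card : ℝ) - 3 / 10000 * u ≤ (Q.filter (G.Adj p)).card)
    (hQ : ∀ q ∈ Q, (P.card : ℝ) - 3 / 10000 * u ≤ (P.filter (G.Adj q)).card)
    (x : V)
    (hx : (10 / 10000) * u ≤ (Q.filter (G.Adj x)).card)
    (hy : (10 / 10000) * u ≤ (P.filter (G.Adj x)).card) :
    0.24 * u ^ 2 ≤ countEdgesInC G (2 * k + 1) := by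
  have hk0 : (2 : ℝ) ≤ k := by exact_mod_cast hk
  have hc := count_lemma G P Q hd (2 * k + 1) (0.495 * u) (0.495 * u) (by nlinarith)
    (Q \ {x}) Finset.sdiff_subset
    (by
      have := card_sdiff_ge Q {x} 1 (by simp)
      linarith)
    (by
      intro q hq
      simp only [Finset.mem_sdiff, Finset.mem_singleton] at hq
      have hqq := hQ q hq.1
      obtain ⟨y, hy1, hy2⟩ : ∃ y, G.Adj x y ∧ G.Adj y q := by
        have h1 := Finset.card_union_add_card_inter (P.filter (G.Adj q)) (P.filter (G.Adj x))
        have h2 : (P.filter (G.Adj q) ∪ P.filter (G.Adj x)).card ≤ P.card :=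
          Finset.card_le_card
            (Finset.union_subset (Finset.filter_subset _ _) (Finset.filter_subset _ _))
        have h1' : (((P.filter (G.Adj q)).card + (P.filter (G.Adj x)).card : ℕ) : ℝ)
          ≤ (P.card + (P.filter (G.Adj q) ∩ P.filter (G.Adj x)).card : ℕ) := by
            exact_mod_cast by omega
        push_cast at h1'
        have h3 : (0 : ℝ) < (P.filter (G.Adj q) ∩ P.filter (G.Adj x)).card := by linarith
        obtain ⟨y, hy⟩ := Finset.card_pos.mp (by exact_mod_cast h3)
        simp only [Finset.mem_inter, Finset.mem_filter] at hy
        exact ⟨y, hy.2.2, hy.1.2.symm⟩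
      refine ⟨P.filter (G.Adj q) \ {x, y}, Finset.sdiff_subset.trans (Finset.filter_subset _ _),
        ?_, ?_⟩
      · have := card_sdiff_ge (P.filter (G.Adj q)) {x, y} 2
          (by exact_mod_cast Finset.card_le_two)
        linarith
      · intro p hp
        simp only [Finset.mem_sdiff, Finset.mem_filter, Finset.mem_insert, Finset.mem_singleton,
          not_or] at hp
        exact ⟨hp.1.2, occurs_lemma G P Q (3 / 10000 * u) (2 * k) x k hk hP hQ (by linarith)
          (by linarith) (by linarith) le_rfl p q y hp.1.1 hp.1.2 hy2 hy1 hp.2.1 hp.2.2 hq.2⟩)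
  nlinarith [sq_nonneg u]

theorem core_bip [Fintype V] (P Q : Finset V) (hPU : P ⊆ U) (hQU : Q ⊆ U)
    (hd : Disjoint P Q) (k : ℕ) (hk : 2 ≤ k)
    (hu : 1000000 * ((k : ℝ) + 1) ≤ U.card)
    (hdeg : ∀ v ∈ U, (1 / 2 - 1 / 10000) * (U.card : ℝ) ≤ (nbs G U v).card)
    (hD : U.card ^ 2 < 2 * dsum G U)
    (hPc : (1 / 2 - 3 / 10000) * (U.card : ℝ) ≤ P.card)
    (hQc : (1 / 2 - 3 / 10000) * (U.card : ℝ) ≤ Q.card)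
    (hP : ∀ p ∈ P, (Q.card : ℝ) - 3 / 10000 * (U.card : ℝ) ≤ (Q.filter (G.Adj p)).card)
    (hQ : ∀ q ∈ Q, (P.card : ℝ) - 3 / 10000 * (U.card : ℝ) ≤ (P.filter (G.Adj q)).card) :
    0.24 * (U.card : ℝ) ^ 2 ≤ countEdgesInC G (2 * k + 1) := by
  classical
  by_cases hex : ∃ x ∈ U, (10 / 10000) * (U.card : ℝ) ≤ (Q.filter (G.Adj x)).card ∧
      (10 / 10000) * (U.card : ℝ) ≤ (P.filter (G.Adj x)).card
  · obtain ⟨x, _, h1, h2⟩ := hex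
    exact fin_two G P Q hd k hk _ hu hPc hQc hP hQ x h1 h2
  push Not at hex
  have hsplit : ∀ v ∈ U, (1 / 2 - 7 / 10000) * (U.card : ℝ) ≤
      (P.filter (G.Adj v)).card + (Q.filter (G.Adj v)).card := by
    intro v hv
    have h1 : nbs G U v ⊆ P.filter (G.Adj v) ∪ Q.filter (G.Adj v) ∪ (U \ (P ∪ Q)) := by
      intro z hz
      have := Finset.mem_filter.mp hz
      simp only [Finset.mem_union, Finset.mem_filter, Finset.mem_sdiff]
      tauto
    have h2 := Finset.card_le_card h1
    have h3 := Finset.card_union_le (P.filter (G.Adj v) ∪ Q.filter (G.Adj v)) (U \ (P ∪ Q))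
    have h4 := Finset.card_union_le (P.filter (G.Adj v)) (Q.filter (G.Adj v))
    have h5 := Finset.card_sdiff_add_card_eq_card (Finset.union_subset hPU hQU)
    rw [Finset.card_union_of_disjoint hd] at h5
    have h6 : ((nbs G U v).card : ℝ) + P.card + Q.card ≤
        (P.filter (G.Adj v)).card + (Q.filter (G.Adj v)).card + U.card := by
      exact_mod_cast by omega
    have := hdeg v hv
    linarith
  set A := U.filter (fun v => ((P.filter (G.Adj v)).card : ℝ) < (10 / 10000) * (U.card : ℝ)) with hA
  set B := U.filter (fun v => ¬ ((P.filter (G.Adj v)).card : ℝ) < (10 / 10000) * (U.card : ℝ))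
    with hB
  have hAB : A.card + B.card = U.card := Finset.card_filter_add_card_filter_not _
  by_cases hAe : ∃ x ∈ A, ∃ y ∈ A, G.Adj x y
  · obtain ⟨x, hx, y, hy, hxy⟩ := hAe
    have hx := Finset.mem_filter.mp hx
    have hy := Finset.mem_filter.mp hy
    have h1 := hsplit x hx.1
    have h2 := hsplit y hy.1
    exact fin_one G P Q hd k hk _ hu hPc hQc hP hQ x y hxy (by linarith) (by linarith)
  by_cases hBe : ∃ x ∈ B, ∃ y ∈ B, G.Adj x y
  · obtain ⟨x, hx, y, hy, hxy⟩ := hBe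
    have hx := Finset.mem_filter.mp hx
    have hy := Finset.mem_filter.mp hy
    have h1 := hsplit x hx.1
    have h2 := hsplit y hy.1
    have h3 : ((Q.filter (G.Adj x)).card : ℝ) < (10 / 10000) * (U.card : ℝ) := by
      by_contra hcon
      exact hx.2 (hex x hx.1 (not_lt.mp hcon))
    have h4 : ((Q.filter (G.Adj y)).card : ℝ) < (10 / 10000) * (U.card : ℝ) := by
      by_contra hcon
      exact hy.2 (hex y hy.1 (not_lt.mp hcon))
    exact fin_one G Q P hd.symm k hk _ hu hQc hPc hQ hP x y hxy (by linarith) (by linarith)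
  exfalso
  push Not at hAe hBe
  have hs : dsum G U = ∑ a ∈ A, (nbs G U a).card + ∑ a ∈ B, (nbs G U a).card := by
    unfold dsum
    rw [hA, hB, Finset.sum_filter_add_sum_filter_not]
  have h1 : ∀ a ∈ A, (nbs G U a).card ≤ B.card := by
    intro a ha
    apply Finset.card_le_card
    intro z hz
    have hz := Finset.mem_filter.mp hz
    refine Finset.mem_filter.mpr ⟨hz.1, fun h => hAe a ha z (Finset.mem_filter.mpr ⟨hz.1, h⟩) hz.2⟩
  have h2 : ∀ a ∈ B, (nbs G U a).card ≤ A.card := by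
    intro a ha
    apply Finset.card_le_card
    intro z hz
    have hz := Finset.mem_filter.mp hz
    by_contra hcon
    refine hBe a ha z (Finset.mem_filter.mpr ⟨hz.1, fun h => hcon ?_⟩) hz.2
    exact Finset.mem_filter.mpr ⟨hz.1, h⟩
  have h3 := Finset.sum_le_card_nsmul A _ _ h1
  have h4 := Finset.sum_le_card_nsmul B _ _ h2
  simp only [smul_eq_mul] at h3 h4
  rw [← hAB] at hD
  zify at *
  nlinarith [sq_nonneg ((A.card : ℤ) - B.card)]

theorem typ_size (u v : V) (x : ℝ) (hx : 0 < x) (hxU : x = U.card) (hd : (1 / 2 - 1 / 10000) * x ≤ (nbs G U u).card)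
    (h : (tri G U u : ℝ) + x * (cod G U u v).card ≤ x ^ 2 / 100000000) :
    (1 / 2 - 3 / 10000) * x ≤ (typ G U u v ⌊x / 10000⌋₊).card := by
  have h1 := typ_card G U u v ⌊x / 10000⌋₊
  have h2 := Nat.lt_floor_add_one (x / 10000)
  set r : ℝ := (⌊x / 10000⌋₊ : ℝ) + 1 with hr
  have h3 : r * (nbs G U u).card ≤ r * (typ G U u v ⌊x / 10000⌋₊).card
      + r * (cod G U u v).card + tri G U u := by
    rw [hr]
    exact_mod_cast h1
  have h4 : ((cod G U u v).card : ℝ) ≤ x / 100000000 := by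
    have : (0 : ℝ) ≤ tri G U u := Nat.cast_nonneg _
    by_contra hcon
    push Not at hcon
    nlinarith
  have h5 : (tri G U u : ℝ) ≤ r * (x / 10000) := by
    have : 0 ≤ x * ((cod G U u v).card : ℝ) := by positivity
    nlinarith
  have hr0 : 0 < r := by linarith [div_pos hx (by norm_num : (0 : ℝ) < 10000)]
  have h6 : r * (nbs G U u).card ≤ r * ((typ G U u v ⌊x / 10000⌋₊).card
      + (cod G U u v).card + x / 10000) := by linarith
  have h7 := le_of_mul_le_mul_left h6 hr0
  linarith

theorem core [Fintype V] (k : ℕ) (hk : 2 ≤ k)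
    (hu : 1000000 * ((k : ℝ) + 1) ≤ U.card)
    (hdeg : ∀ v ∈ U, (1 / 2 - 1 / 10000) * (U.card : ℝ) ≤ (nbs G U v).card)
    (hD : U.card ^ 2 < 2 * dsum G U)
    (hT : (tau G U : ℝ) ≤ (U.card : ℝ) ^ 3 / 1000000000) :
    0.24 * (U.card : ℝ) ^ 2 ≤ countEdgesInC G (2 * k + 1) := by
  have hk0 : (2 : ℝ) ≤ k := by exact_mod_cast hk
  set x : ℝ := (U.card : ℝ) with hx
  have hx0 : 1000000 ≤ x := by linarith
  have hxp : 0 < x := by linarith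
  have hD' : x ^ 2 < 2 * dsum G U := by rw [hx]; exact_mod_cast hD
  have hK1 := Nat.floor_le (show 0 ≤ x ^ 2 / 100000000 by positivity)
  have hK2 := Nat.lt_floor_add_one (x ^ 2 / 100000000)
  obtain ⟨u, hu1, v, hv1, huv, hs⟩ := good_dart G U ⌊x ^ 2 / 100000000⌋₊ (by
    have hxx : 1000000 * x ≤ x ^ 2 := by nlinarith
    have hK3 : x ^ 2 / 125000000 ≤ ⌊x ^ 2 / 100000000⌋₊ := by linarith
    have : 3 * x * (tau G U : ℝ) < ⌊x ^ 2 / 100000000⌋₊ * (dsum G U : ℝ) := by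
      calc 3 * x * (tau G U : ℝ) ≤ 3 * x * (x ^ 3 / 1000000000) := by gcongr
        _ < x ^ 2 / 125000000 * (x ^ 2 / 2) := by
          have : 0 < x ^ 4 := by positivity
          nlinarith
        _ ≤ _ := by gcongr; linarith
    rw [hx] at this ⊢
    exact_mod_cast this)
  have hs' : (tri G U u : ℝ) + tri G U v + x * (cod G U u v).card ≤ x ^ 2 / 100000000 := by
    refine le_trans ?_ hK1
    rw [hx] at hs ⊢
    exact_mod_cast hs
  have ht1 : (0 : ℝ) ≤ tri G U u := Nat.cast_nonneg _
  have ht2 : (0 : ℝ) ≤ tri G U v := Nat.cast_nonneg _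
  have hcc : cod G U v u = cod G U u v := Finset.inter_comm _ _
  have hf := Nat.floor_le (show 0 ≤ x / 10000 by positivity)
  have key : ∀ u ∈ U, ∀ v ∈ U, ∀ a ∈ typ G U u v ⌊x / 10000⌋₊,
      ((typ G U v u ⌊x / 10000⌋₊).card : ℝ) - 3 / 10000 * x ≤
        ((typ G U v u ⌊x / 10000⌋₊).filter (G.Adj a)).card := by
    intro u hu v hv a ha
    have h1 := typ_adj G U u v ⌊x / 10000⌋₊ ⌊x / 10000⌋₊ a ha
    have h2 : ((typ G U v u ⌊x / 10000⌋₊).card : ℝ) + (nbs G U u).card + (nbs G U a).card ≤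
      ((typ G U v u ⌊x / 10000⌋₊).filter (G.Adj a)).card + x + ⌊x / 10000⌋₊ := by
      rw [hx] at h1 ⊢
      exact_mod_cast h1
    have haU : a ∈ U := nbs_sub G U u (Finset.mem_filter.mp ha).1
    have := hdeg u hu
    have := hdeg a haU
    linarith
  refine core_bip G U (typ G U u v ⌊x / 10000⌋₊) (typ G U v u ⌊x / 10000⌋₊)
    ((Finset.filter_subset _ _).trans (nbs_sub G U u))
    ((Finset.filter_subset _ _).trans (nbs_sub G U v))
    (typ_disj G U u v _ _) k hk hu hdeg hD ?_ ?_ (key u hu1 v hv1) (key v hv1 u hu1)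
  · exact typ_size G U u v x hxp hx (hdeg u hu1) (by linarith)
  · exact typ_size G U v u x hxp hx (hdeg v hv1) (by rw [hcc]; linarith)

theorem dsum_erase (v : V) (hv : v ∈ U) :
    dsum G U = dsum G (U.erase v) + 2 * (nbs G U v).card := by
  have h1 : ∀ a ∈ U.erase v, (nbs G U a).card
      = (nbs G (U.erase v) a).card + if G.Adj v a then 1 else 0 := by
    intro a ha
    unfold nbs
    rw [Finset.filter_erase]
    split_ifs with h
    · rw [Finset.card_erase_add_one]
      exact Finset.mem_filter.mpr ⟨hv, h.symm⟩
    · rw [Finset.erase_eq_of_notMem]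
      · simp
      · intro hcon
        exact h (Finset.mem_filter.mp hcon).2.symm
  unfold dsum
  rw [← Finset.add_sum_erase U _ hv, Finset.sum_congr rfl h1, Finset.sum_add_distrib,
    ← Finset.card_filter]
  have : (U.erase v).filter (G.Adj v) = nbs G U v := by
    unfold nbs
    rw [Finset.filter_erase, Finset.erase_eq_of_notMem]
    simp
  rw [this]
  ring

theorem main_lemma [Fintype V] (k : ℕ) (hk : 2 ≤ k) (n : ℝ) (hn : n = Fintype.card V)
    (hn0 : 2000000 * ((k : ℝ) + 1) ≤ n)
    (hD : n ^ 2 < 2 * dsum G Finset.univ)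
    (hT : ((27 * triangleCount G : ℕ) : ℝ) ≤ n ^ 3 / 10 ^ 12) :
    0.236 * n ^ 2 ≤ countEdgesInC G (2 * k + 1) := by
  obtain ⟨U, -, hU⟩ := Finset.exists_max_image (Finset.univ : Finset (Finset V))
    (fun U => (dsum G U : ℝ) - (U.card : ℝ) ^ 2 / 2 + n / 10000 * U.card) ⟨∅, Finset.mem_univ _⟩
  have hk0 : (2 : ℝ) ≤ k := by exact_mod_cast hk
  have hnp : 0 < n := by linarith
  have h1 := hU Finset.univ (Finset.mem_univ _)
  simp only [Finset.card_univ, ← hn] at h1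
  set u : ℝ := (U.card : ℝ) with hu
  have hun : u ≤ n := by rw [hu, hn]; exact_mod_cast Finset.card_le_univ U
  have hu0 : 0 ≤ u := Nat.cast_nonneg _
  set s : ℝ := (dsum G U : ℝ) - u ^ 2 / 2 with hs
  have hs1 : n / 10000 * (n - u) < s := by linarith
  have hs0 : 0 < s := lt_of_le_of_lt (by have := sub_nonneg.mpr hun; positivity) hs1
  have hD1 : (dsum G U : ℝ) ≤ u ^ 2 := by
    have : dsum G U ≤ U.card * U.card := by
      unfold dsum
      rw [← smul_eq_mul]
      exact Finset.sum_le_card_nsmul _ _ _ fun a _ => Finset.card_le_card (nbs_sub G U a)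
    rw [hu, pow_two]
    exact_mod_cast this
  have hup : 0 < u := by
    rcases hu0.eq_or_lt with h | h
    · rw [← h] at hD1 hs; norm_num at hD1 hs; rw [hD1] at hs; norm_num at hs; linarith
    · exact h
  have hm : 2 * (dsum G U : ℝ) ^ 2 ≤ u * tau G U + u ^ 2 * dsum G U := by
    rw [hu]; exact_mod_cast mantel_tau G U
  have hτ : (tau G U : ℝ) ≤ n ^ 3 / 10 ^ 12 := le_trans (by exact_mod_cast tau_le G U) hT
  have hDu : u ^ 2 / 2 ≤ dsum G U := by linarith
  have hus : u * s ≤ tau G U := by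
    have h2 : u ^ 2 * s ≤ u * tau G U := by
      have : dsum G U * (2 * s) ≤ u * tau G U := by rw [hs]; linarith
      nlinarith
    have : u * (u * s) ≤ u * tau G U := by linarith
    exact le_of_mul_le_mul_left this hup
  have hu100 : n / 100 ≤ u := by
    by_contra hcon
    push Not at hcon
    have h2 : s ≤ u ^ 2 / 2 := by linarith
    have h3 : u ^ 2 ≤ (n / 100) ^ 2 := by gcongr
    have h4 : n / 10000 * (n - n / 100) ≤ n / 10000 * (n - u) := by gcongr
    nlinarith [sq_nonneg n, mul_pos hnp hnp]
  have hu99 : 0.9999 * n ≤ u := by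
    by_contra hcon
    push Not at hcon
    have h2 : n / 10000 * (n / 10000) ≤ n / 10000 * (n - u) := by gcongr; linarith
    have h3 : n / 100 * (n / 10000 * (n / 10000)) ≤ u * s := by gcongr; linarith
    have : 0 < n ^ 3 := by positivity
    nlinarith
  have hc := core G U k hk (by linarith) (by
      intro v hv
      have h2 := hU (U.erase v) (Finset.mem_univ _)
      have h3 : (dsum G U : ℝ) = dsum G (U.erase v) + 2 * (nbs G U v).card := by
        exact_mod_cast dsum_erase G U v hv
      have h4 : ((U.erase v).card : ℝ) = u - 1 := by
        rw [hu, ← Finset.card_erase_add_one hv]; push_cast; ring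
      simp only [h4] at h2
      nlinarith)
    (by
      have : u ^ 2 < 2 * dsum G U := by linarith
      rw [hu] at this
      exact_mod_cast this)
    (by
      refine hτ.trans ?_
      have h3 : (0.9999 * n) ^ 3 ≤ u ^ 3 := by gcongr
      have : 0 < n ^ 3 := by positivity
      rw [← hu]
      nlinarith)
  rw [← hu] at hc
  have h3 : (0.9999 * n) ^ 2 ≤ u ^ 2 := by gcongr
  nlinarith [sq_nonneg n]

end Helpers

theorem stmt7 :
    ∀ k : ℕ, 2 ≤ k → ∃ δ : ℝ, 0 < δ ∧ ∀ n : ℕ, ∀ G : SimpleGraph (Fin n),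
      G.edgeSet.ncard = n ^ 2 / 4 + 1 →
      (triangleCount G : ℝ) ≤ δ * (n : ℝ) ^ 3 →
      (0.236 : ℝ) * (n : ℝ) ^ 2 ≤ (countEdgesInC G (2 * k + 1) : ℝ) := by
  classical
  intro k hk
  set N : ℝ := 2000000 * ((k : ℝ) + 1) with hN
  have hk0 : (2 : ℝ) ≤ k := by exact_mod_cast hk
  have hN1 : 1 ≤ N := by linarith
  have hNp : 0 < N := by linarith
  refine ⟨1 / (10 ^ 14 * N ^ 3), by positivity, ?_⟩
  intro n G he hT
  have hD0 : dsum G Finset.univ = 2 * (n ^ 2 / 4 + 1) := by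
    have h1 := G.sum_degrees_eq_twice_card_edges
    have h2 : G.edgeFinset.card = G.edgeSet.ncard := by
      rw [← Set.ncard_coe_finset, coe_edgeFinset]
    rw [h2, he] at h1
    rw [← h1]
    unfold dsum nbs
    apply Finset.sum_congr rfl
    intro v _
    rw [← card_neighborFinset_eq_degree, neighborFinset_eq_filter]
  have hD1 : n ^ 2 < 2 * dsum G Finset.univ := by omega
  rcases lt_or_ge (n : ℝ) N with hn | hn
  · exfalso
    have hT0 : triangleCount G = 0 := by
      have h1 : (n : ℝ) ^ 3 ≤ N ^ 3 := by gcongr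
      have h2 : 1 / (10 ^ 14 * N ^ 3) * (n : ℝ) ^ 3 < 1 := by
        rw [div_mul_eq_mul_div, div_lt_one (by positivity)]
        have : 0 < N ^ 3 := by positivity
        linarith
      have h3 : (triangleCount G : ℝ) < 1 := lt_of_le_of_lt hT h2
      have h4 : triangleCount G < 1 := by exact_mod_cast h3
      omega
    have h1 := tau_le G Finset.univ
    rw [hT0] at h1
    have h2 : tau G Finset.univ = 0 := by omega
    have h3 := mantel_tau G Finset.univ
    rw [h2, Finset.card_univ, Fintype.card_fin] at h3
    have h4 : 0 < dsum G Finset.univ := by omega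
    nlinarith
  · refine main_lemma G k hk n (by simp) hn (by exact_mod_cast hD1) ?_
    push_cast
    have h1 : 1 / (10 ^ 14 * N ^ 3) ≤ 1 / 10 ^ 14 := by
      apply one_div_le_one_div_of_le (by positivity)
      have : 1 ≤ N ^ 3 := one_le_pow₀ hN1
      linarith
    have h2 : 1 / (10 ^ 14 * N ^ 3) * (n : ℝ) ^ 3 ≤ 1 / 10 ^ 14 * (n : ℝ) ^ 3 := by gcongr
    have : 0 ≤ (n : ℝ) ^ 3 := by positivity
    linarith
end

section
/- For every δ > 0 there exists a constant C > 0 such that the following holds: if G is a simple graph on n vertices with exactly ⌊n²/4⌋ + 1 edges and at least δ·n³ triangles, and the edge set of G is partitioned into a set R of red edges and a set B of blue edges such that no blue edge lies on a cycle of length 5 in G, then |R| ≥ ((2+√2)/16)·n² − C·n^{15/8}. -/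
open SimpleGraph

open Classical in
/-- The bilinear form of the adjacency matrix. -/
noncomputable def qf {V : Type*} [Fintype V] (H : SimpleGraph V) (f g : V → ℝ) : ℝ :=
  ∑ u, ∑ v, (if H.Adj u v then f u * g v else 0)

section forms
variable {V : Type*} [Fintype V]

lemma qf_comm (H : SimpleGraph V) (f g : V → ℝ) : qf H f g = qf H g f := by
  classical
  unfold qf
  rw [Finset.sum_comm]
  refine Finset.sum_congr rfl fun u _ => Finset.sum_congr rfl fun v _ => ?_
  simp only [H.adj_comm v u, mul_comm]

lemma qf_add_right (H : SimpleGraph V) (f g k : V → ℝ) :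
    qf H f (g + k) = qf H f g + qf H f k := by
  classical
  unfold qf
  simp only [← Finset.sum_add_distrib]
  refine Finset.sum_congr rfl fun u _ => Finset.sum_congr rfl fun v _ => ?_
  split_ifs <;> simp [mul_add]

lemma qf_add_left (H : SimpleGraph V) (f g k : V → ℝ) :
    qf H (f + g) k = qf H f k + qf H g k := by
  rw [qf_comm, qf_add_right, qf_comm H k f, qf_comm H k g]

lemma qf_smul_right (H : SimpleGraph V) (f g : V → ℝ) (c : ℝ) :
    qf H f (c • g) = c * qf H f g := by
  classical
  unfold qf
  simp only [Finset.mul_sum]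
  refine Finset.sum_congr rfl fun u _ => Finset.sum_congr rfl fun v _ => ?_
  split_ifs <;> simp
  ring

lemma qf_smul_left (H : SimpleGraph V) (f g : V → ℝ) (c : ℝ) :
    qf H (c • f) g = c * qf H f g := by
  rw [qf_comm, qf_smul_right, qf_comm]

lemma qf_single_single [DecidableEq V] (H : SimpleGraph V) (a b : V) (h : ¬ H.Adj a b) :
    qf H (Pi.single a 1) (Pi.single b 1) = 0 := by
  classical
  unfold qf
  refine Finset.sum_eq_zero fun u _ => Finset.sum_eq_zero fun v _ => ?_
  split_ifs with huv
  · by_cases hu : u = a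
    · by_cases hv : v = b
      · subst hu hv; exact absurd huv h
      · simp [hv]
    · simp [hu]
  · rfl

lemma qf_nonneg (H : SimpleGraph V) (f g : V → ℝ) (hf : ∀ v, 0 ≤ f v) (hg : ∀ v, 0 ≤ g v) :
    0 ≤ qf H f g := by
  classical
  unfold qf
  refine Finset.sum_nonneg fun u _ => Finset.sum_nonneg fun v _ => ?_
  split_ifs
  · exact mul_nonneg (hf u) (hg v)
  · exact le_rfl

/-- Moving weights along a direction supported on three pairwise nonadjacent vertices. -/
lemma qf_move [DecidableEq V] (H : SimpleGraph V) (w : V → ℝ) (a b c : V)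
    (hab : ¬ H.Adj a b) (hac : ¬ H.Adj a c) (hbc : ¬ H.Adj b c) (x y z : ℝ) :
    let d : V → ℝ := x • Pi.single a 1 + y • Pi.single b 1 + z • Pi.single c 1
    qf H (w + d) (w + d) = qf H w w + 2 * (x * qf H w (Pi.single a 1)
      + y * qf H w (Pi.single b 1) + z * qf H w (Pi.single c 1)) := by
  intro d
  have hd : qf H d d = 0 := by
    simp only [d, qf_add_left, qf_add_right, qf_smul_left, qf_smul_right]
    rw [qf_single_single H a b hab, qf_single_single H a c hac, qf_single_single H b c hbc,
      qf_single_single H a a (H.irrefl), qf_single_single H b b (H.irrefl),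
      qf_single_single H c c (H.irrefl), qf_single_single H b a (fun h => hab h.symm),
      qf_single_single H c a (fun h => hac h.symm), qf_single_single H c b (fun h => hbc h.symm)]
    ring
  have hwd : qf H w d = x * qf H w (Pi.single a 1)
      + y * qf H w (Pi.single b 1) + z * qf H w (Pi.single c 1) := by
    simp only [d, qf_add_right, qf_smul_right]
  rw [qf_add_left, qf_add_right H w w d, qf_add_right H d w d, hd, qf_comm H d w, hwd]
  ring

end forms

/-- Three-variable move, with fixed direction. -/
lemma move_dir (w1 w2 w3 d1 d2 d3 : ℝ) (h1 : 0 < w1) (h2 : 0 < w2) (h3 : 0 < w3)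
    (hs : d1 + d2 + d3 = 0) (hne : ¬ (d1 = 0 ∧ d2 = 0 ∧ d3 = 0)) :
    ∃ t : ℝ, 0 ≤ t ∧ 0 ≤ w1 + t * d1 ∧ 0 ≤ w2 + t * d2 ∧ 0 ≤ w3 + t * d3 ∧
      (w1 + t * d1 = 0 ∨ w2 + t * d2 = 0 ∨ w3 + t * d3 = 0) := by
  -- scale: let r = max (-d_i / w_i), which is positive
  set r := max (-d1 / w1) (max (-d2 / w2) (-d3 / w3)) with hr
  have r1 : -d1 / w1 ≤ r := le_max_left _ _
  have r2 : -d2 / w2 ≤ r := le_trans (le_max_left _ _) (le_max_right _ _)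
  have r3 : -d3 / w3 ≤ r := le_trans (le_max_right _ _) (le_max_right _ _)
  rw [div_le_iff₀ h1] at r1
  rw [div_le_iff₀ h2] at r2
  rw [div_le_iff₀ h3] at r3
  have hrpos : 0 < r := by
    by_contra hcon
    have hr0 : r ≤ 0 := not_lt.mp hcon
    have a1 : 0 ≤ d1 := by nlinarith
    have a2 : 0 ≤ d2 := by nlinarith
    have a3 : 0 ≤ d3 := by nlinarith
    exact hne ⟨by linarith, by linarith, by linarith⟩
  have key : ∀ w d : ℝ, -d ≤ r * w → 0 ≤ w + 1 / r * d := by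
    intro w d h
    have : w + 1 / r * d = (r * w + d) / r := by field_simp
    rw [this]; apply div_nonneg _ hrpos.le; linarith
  have keq : ∀ w d : ℝ, 0 < w → r = -d / w → w + 1 / r * d = 0 := by
    intro w d hw h
    have h' : r * w = -d := by rw [h]; field_simp
    have : w + 1 / r * d = (r * w + d) / r := by field_simp
    rw [this, h']; simp
  refine ⟨1 / r, by positivity, key _ _ r1, key _ _ r2, key _ _ r3, ?_⟩
  rcases max_choice (-d1 / w1) (max (-d2 / w2) (-d3 / w3)) with h | h
  · left; exact keq _ _ h1 (hr.trans h)
  · rcases max_choice (-d2 / w2) (-d3 / w3) with h' | h'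
    · right; left; exact keq _ _ h2 (hr.trans (h.trans h'))
    · right; right; exact keq _ _ h3 (hr.trans (h.trans h'))

lemma move_three (w1 w2 w3 D1 D2 D3 B1 B2 B3 : ℝ) (h1 : 0 < w1) (h2 : 0 < w2) (h3 : 0 < w3) :
    ∃ x y z : ℝ, x + y + z = 0 ∧ x * D1 + y * D2 + z * D3 = 0 ∧
      0 ≤ x * B1 + y * B2 + z * B3 ∧ 0 ≤ w1 + x ∧ 0 ≤ w2 + y ∧ 0 ≤ w3 + z ∧
      (w1 + x = 0 ∨ w2 + y = 0 ∨ w3 + z = 0) := by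
  have hd : ∃ d1 d2 d3 : ℝ, d1 + d2 + d3 = 0 ∧ d1 * D1 + d2 * D2 + d3 * D3 = 0 ∧
      ¬ (d1 = 0 ∧ d2 = 0 ∧ d3 = 0) := by
    by_cases hD : D1 = D2 ∧ D2 = D3
    · exact ⟨1, -1, 0, by ring, by rw [hD.1]; ring, by simp⟩
    · refine ⟨D3 - D2, D1 - D3, D2 - D1, by ring, by ring, ?_⟩
      rintro ⟨a, b, c⟩
      exact hD ⟨by linarith, by linarith⟩
  obtain ⟨d1, d2, d3, hs, hD, hne⟩ := hd
  have hd' : ∃ d1 d2 d3 : ℝ, d1 + d2 + d3 = 0 ∧ d1 * D1 + d2 * D2 + d3 * D3 = 0 ∧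
      0 ≤ d1 * B1 + d2 * B2 + d3 * B3 ∧ ¬ (d1 = 0 ∧ d2 = 0 ∧ d3 = 0) := by
    rcases le_total 0 (d1 * B1 + d2 * B2 + d3 * B3) with h | h
    · exact ⟨d1, d2, d3, hs, hD, h, hne⟩
    · refine ⟨-d1, -d2, -d3, by linarith, by linarith, by linarith, ?_⟩
      simpa using hne
  obtain ⟨e1, e2, e3, hs', hD', hB', hne'⟩ := hd'
  obtain ⟨t, ht, k1, k2, k3, k⟩ := move_dir w1 w2 w3 e1 e2 e3 h1 h2 h3 hs' hne'
  refine ⟨t * e1, t * e2, t * e3, ?_, ?_, ?_, k1, k2, k3, k⟩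
  · linear_combination t * hs'
  · linear_combination t * hD'
  · have := mul_nonneg ht hB'
    linarith

/-- The final numerical inequality. -/
lemma final_num (p q x y : ℝ) (hp : 0 ≤ p) (hq : 0 ≤ q) (hx : 0 ≤ x) (hy : 0 ≤ y)
    (hs : p + q + x + y = 1) (he : 1 / 2 < 2 * (p * (q + x)) + 2 * (x * y) + y ^ 2) :
    p * q ≤ (2 - Real.sqrt 2) / 16 := by
  set s := Real.sqrt 2 with hsdef
  have hs2 : s ^ 2 = 2 := Real.sq_sqrt (by norm_num)
  have hs0 : 0 < s := Real.sqrt_pos.mpr (by norm_num)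
  -- r = p - x, d = y - r
  have hq' : q = 1 - p - x - y := by linarith
  have h1 : (1 - 2 * p) ^ 2 / 2 + (p - x) ^ 2 < (y - (p - x)) ^ 2 := by
    subst hq'; nlinarith
  have hypos : 0 < y := by
    rcases hy.eq_or_lt with h | h
    · rw [← h] at h1; nlinarith [sq_nonneg (1 - 2 * p)]
    · exact h
  have h2 : 0 < y - 2 * (p - x) := by
    by_contra hcon
    have : y * (y - 2 * (p - x)) ≤ 0 := mul_nonpos_of_nonneg_of_nonpos hy (not_lt.mp hcon)
    nlinarith [sq_nonneg (1 - 2 * p)]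
  have hd : 0 < y - (p - x) := by linarith
  have hp2 : 0 ≤ 1 - 2 * p := by linarith
  have h3 : (1 - 2 * p) * s / 2 ≤ y - (p - x) := by
    apply (sq_le_sq₀ (by positivity) hd.le).mp
    have : ((1 - 2 * p) * s / 2) ^ 2 = (1 - 2 * p) ^ 2 / 2 := by
      rw [div_pow, mul_pow, hs2]; ring
    rw [this]; nlinarith [sq_nonneg (p - x)]
  have h4 : q ≤ (1 - 2 * p) * (1 - s / 2) := by rw [hq']; linarith
  have hs3 : s < 2 := by nlinarith
  calc p * q ≤ p * ((1 - 2 * p) * (1 - s / 2)) := mul_le_mul_of_nonneg_left h4 hp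
    _ ≤ (2 - s) / 16 := by nlinarith [mul_nonneg (sq_nonneg (4 * p - 1)) (by linarith : 0 ≤ 2 - s)]

/-- No blue edge lies on a closed walk of length five. -/
structure CleanPair {V : Type*} (G B : SimpleGraph V) : Prop where
  le : B ≤ G
  tri : ∀ u v a b, B.Adj u v → G.Adj u a → G.Adj u b → ¬ G.Adj a b
  five : ∀ u v x y z, B.Adj u v → G.Adj u x → G.Adj x y → G.Adj y z → ¬ G.Adj z v

section weighted
variable {V : Type*} [Fintype V]

/-- Weighted Mantel theorem. -/
lemma mantel_weighted (G : SimpleGraph V) (w : V → ℝ) (hw : ∀ v, 0 ≤ w v) (hsum : ∑ v, w v = 1)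
    (hfree : ∀ a b c, 0 < w a → 0 < w b → 0 < w c → G.Adj a b → G.Adj a c → ¬ G.Adj b c) :
    qf G w w ≤ 1 / 2 := by
  classical
  set d : V → ℝ := fun u => ∑ v, if G.Adj u v then w v else 0 with hd
  have hQ : qf G w w = ∑ u, w u * d u := by
    unfold qf
    refine Finset.sum_congr rfl fun u _ => ?_
    rw [hd, Finset.mul_sum]
    refine Finset.sum_congr rfl fun v _ => ?_
    split_ifs <;> simp
  have h1 : ∑ u, ∑ v, (if G.Adj u v then w u * w v * d u else 0) = ∑ u, w u * d u ^ 2 := by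
    refine Finset.sum_congr rfl fun u _ => ?_
    have : w u * d u ^ 2 = (w u * d u) * ∑ v, if G.Adj u v then w v else 0 := by
      rw [sq, mul_assoc]
    rw [this, Finset.mul_sum]
    refine Finset.sum_congr rfl fun v _ => ?_
    split_ifs <;> ring
  have h2 : ∑ u, ∑ v, (if G.Adj u v then w u * w v * d v else 0) = ∑ u, w u * d u ^ 2 := by
    rw [← h1, Finset.sum_comm]
    refine Finset.sum_congr rfl fun u _ => Finset.sum_congr rfl fun v _ => ?_
    simp only [G.adj_comm v u, mul_comm (w v)]
  have h3 : ∑ u, ∑ v, (if G.Adj u v then w u * w v * (d u + d v) else 0) ≤ qf G w w := by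
    unfold qf
    refine Finset.sum_le_sum fun u _ => Finset.sum_le_sum fun v _ => ?_
    split_ifs with huv
    · rcases (hw u).eq_or_lt with hu | hu
      · simp [← hu]
      rcases (hw v).eq_or_lt with hv | hv
      · simp [← hv]
      have : d u + d v ≤ 1 := by
        rw [← hsum, hd, ← Finset.sum_add_distrib]
        refine Finset.sum_le_sum fun c _ => ?_
        rcases (hw c).eq_or_lt with hc | hc
        · simp [← hc]
        have := hfree u v c hu hv hc huv
        split_ifs with k1 k2 k2
        · exact absurd k2 (this k1)
        · simp
        · simp
        · simpa using hc.le
      nlinarith [mul_pos hu hv]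
    · exact le_rfl
  have h4 : ∑ u, ∑ v, (if G.Adj u v then w u * w v * (d u + d v) else 0)
      = 2 * ∑ u, w u * d u ^ 2 := by
    rw [two_mul]
    nth_rw 1 [← h1]
    rw [← h2, ← Finset.sum_add_distrib]
    refine Finset.sum_congr rfl fun u _ => ?_
    rw [← Finset.sum_add_distrib]
    refine Finset.sum_congr rfl fun v _ => ?_
    split_ifs <;> ring
  have h5 : 0 ≤ ∑ u, w u * (d u - qf G w w) ^ 2 :=
    Finset.sum_nonneg fun u _ => mul_nonneg (hw u) (sq_nonneg _)
  have h6 : ∑ u, w u * (d u - qf G w w) ^ 2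
      = ∑ u, w u * d u ^ 2 - 2 * qf G w w * ∑ u, w u * d u + qf G w w ^ 2 * ∑ u, w u := by
    rw [Finset.mul_sum, Finset.mul_sum, ← Finset.sum_sub_distrib, ← Finset.sum_add_distrib]
    refine Finset.sum_congr rfl fun u _ => ?_
    ring
  rw [h6, ← hQ, hsum] at h5
  nlinarith [qf_nonneg G w w hw hw]

/-- The bound for the reduced structure, where `v` has `u` as its only neighbour. -/
lemma reduced_case {G B : SimpleGraph V} (hc : CleanPair G B) (w : V → ℝ) (hw : ∀ v, 0 ≤ w v)
    (hsum : ∑ v, w v = 1) (hG : 1 / 2 < qf G w w)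
    (hno : ∀ a b c, 0 < w a → 0 < w b → 0 < w c → a ≠ b → a ≠ c → b ≠ c →
      ¬ G.Adj a b → ¬ G.Adj a c → G.Adj b c)
    (u v : V) (huv : B.Adj u v) (hu : 0 < w u) (hv : 0 < w v)
    (honly : ∀ a, 0 < w a → G.Adj v a → a = u)
    (a b c : V) (ha : 0 < w a) (hb : 0 < w b) (hcc : 0 < w c)
    (hab : G.Adj a b) (hac : G.Adj a c) (hbc : G.Adj b c) :
    qf B w w ≤ (2 - Real.sqrt 2) / 8 := by
  classical
  have huvG := hc.le huv
  have huvne : u ≠ v := huvG.ne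
  -- the vertices other than u and v form a clique
  have hcl : ∀ x y, 0 < w x → 0 < w y → x ≠ y → x ≠ u → x ≠ v → y ≠ u → y ≠ v → G.Adj x y := by
    intro x y hx hy hxy xu xv yu yv
    exact hno v x y hv hx hy (Ne.symm xv) (Ne.symm yv) hxy (fun h => xu (honly x hx h))
      (fun h => yu (honly y hy h))
  have tu : ∀ x y, G.Adj u x → G.Adj u y → ¬ G.Adj x y := fun x y => hc.tri u v x y huv
  have tv : ∀ x y, G.Adj v x → G.Adj v y → ¬ G.Adj x y := fun x y => hc.tri v u x y huv.symm
  have nau : a ≠ u := by rintro rfl; exact tu _ _ hab hac hbc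
  have nav : a ≠ v := by rintro rfl; exact tv _ _ hab hac hbc
  have nbu : b ≠ u := by rintro rfl; exact tu _ _ hab.symm hbc hac
  have nbv : b ≠ v := by rintro rfl; exact tv _ _ hab.symm hbc hac
  have ncu : c ≠ u := by rintro rfl; exact tu _ _ hac.symm hbc.symm hab
  have ncv : c ≠ v := by rintro rfl; exact tv _ _ hac.symm hbc.symm hab
  -- no blue edge touches the clique
  have hblue : ∀ x y, 0 < w x → 0 < w y → B.Adj x y → x = u ∨ x = v := by
    intro x y hx hy hxy
    by_contra hcon
    push Not at hcon
    obtain ⟨xu, xv⟩ := hcon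
    have t := fun p q => hc.tri x y p q hxy
    by_cases xa : x = a
    · subst xa; exact t _ _ hab hac hbc
    by_cases xb : x = b
    · subst xb; exact t _ _ hab.symm hbc hac
    exact t _ _ (hcl x a hx ha xa xu xv nau nav) (hcl x b hx hb xb xu xv nbu nbv) hab
  set fu : V → ℝ := fun z => if z = u then w z else 0 with hfu
  set fv : V → ℝ := fun z => if z = v then w z else 0 with hfv
  set fx : V → ℝ := fun z => if z ≠ u ∧ z ≠ v ∧ G.Adj u z then w z else 0 with hfx
  set fy : V → ℝ := fun z => if z ≠ u ∧ z ≠ v ∧ ¬ G.Adj u z then w z else 0 with hfy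
  have nfu : ∀ z, 0 ≤ fu z := fun z => by simp only [hfu]; split_ifs <;> simp [hw]
  have nfv : ∀ z, 0 ≤ fv z := fun z => by simp only [hfv]; split_ifs <;> simp [hw]
  have nfx : ∀ z, 0 ≤ fx z := fun z => by simp only [hfx]; split_ifs <;> simp [hw]
  have nfy : ∀ z, 0 ≤ fy z := fun z => by simp only [hfy]; split_ifs <;> simp [hw]
  have hsplit : ∀ z, w z = fu z + fv z + fx z + fy z := by
    intro z
    simp only [hfu, hfv, hfx, hfy]
    by_cases z1 : z = u
    · have : z ≠ v := by rw [z1]; exact huvne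
      simp [z1, huvne]
    · by_cases z2 : z = v
      · simp [z2, Ne.symm huvne]
      · by_cases z3 : G.Adj u z <;> simp [z1, z2, z3]
  have prodsum : ∀ f g : V → ℝ, ∑ i, ∑ j, f i * g j = (∑ i, f i) * ∑ j, g j := by
    intro f g; rw [Finset.sum_mul_sum]
  have hB : qf B w w ≤ 2 * ((∑ i, fu i) * ∑ i, fv i) := by
    have : qf B w w ≤ ∑ i, ∑ j, (fu i * fv j + fv i * fu j) := by
      unfold qf
      refine Finset.sum_le_sum fun i _ => Finset.sum_le_sum fun j _ => ?_
      have hnn : 0 ≤ fu i * fv j + fv i * fu j :=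
        add_nonneg (mul_nonneg (nfu _) (nfv _)) (mul_nonneg (nfv _) (nfu _))
      split_ifs with hij
      · rcases (hw i).eq_or_lt with hi | hi
        · simpa [← hi] using hnn
        rcases (hw j).eq_or_lt with hj | hj
        · simpa [← hj] using hnn
        have hne : i ≠ j := (hc.le hij).ne
        rcases hblue i j hi hj hij with h | h <;> rcases hblue j i hj hi hij.symm with h' | h'
        · exact absurd (h.trans h'.symm) hne
        · simp [hfu, hfv, h, h', huvne]
        · simp [hfu, hfv, h, h', huvne, huvne.symm]
        · exact absurd (h.trans h'.symm) hne
      · exact hnn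
    simp only [Finset.sum_add_distrib, prodsum] at this
    linarith
  have hGb : qf G w w ≤ 2 * ((∑ i, fu i) * (∑ i, fv i + ∑ i, fx i))
      + 2 * ((∑ i, fx i) * ∑ i, fy i) + (∑ i, fy i) ^ 2 := by
    have : qf G w w ≤ ∑ i, ∑ j, (fu i * fv j + fv i * fu j + fu i * fx j + fx i * fu j
        + fx i * fy j + fy i * fx j + fy i * fy j) := by
      unfold qf
      refine Finset.sum_le_sum fun i _ => Finset.sum_le_sum fun j _ => ?_
      have hnn : 0 ≤ fu i * fv j + fv i * fu j + fu i * fx j + fx i * fu j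
        + fx i * fy j + fy i * fx j + fy i * fy j := by
        have := mul_nonneg (nfu i) (nfv j)
        have := mul_nonneg (nfv i) (nfu j)
        have := mul_nonneg (nfu i) (nfx j)
        have := mul_nonneg (nfx i) (nfu j)
        have := mul_nonneg (nfx i) (nfy j)
        have := mul_nonneg (nfy i) (nfx j)
        have := mul_nonneg (nfy i) (nfy j)
        linarith
      split_ifs with hij
      · rcases (hw i).eq_or_lt with hi | hi
        · simpa [← hi] using hnn
        rcases (hw j).eq_or_lt with hj | hj
        · simpa [← hj] using hnn
        have hne : i ≠ j := hij.ne
        by_cases iu : i = u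
        · subst iu
          by_cases jv : j = v
          · subst jv; simp [hfu, hfv, hfx, hfy, huvne, huvne.symm]
          · simp [hfu, hfv, hfx, hfy, huvne, hne.symm, jv, hij]
        by_cases iv : i = v
        · subst iv
          have := honly j hj hij
          subst this
          simp [hfu, hfv, hfx, hfy, huvne, huvne.symm]
        by_cases ju : j = u
        · subst ju
          simp [hfu, hfv, hfx, hfy, huvne, iu, iv, hij.symm]
        by_cases jv : j = v
        · subst jv
          exact absurd (honly i hi hij.symm) iu
        by_cases iN : G.Adj u i
        · have jN : ¬ G.Adj u j := fun h => tu i j iN h hij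
          simp [hfu, hfv, hfx, hfy, iu, iv, ju, jv, iN, jN]
        · by_cases jN : G.Adj u j
          · simp [hfu, hfv, hfx, hfy, iu, iv, ju, jv, iN, jN]
          · simp [hfu, hfv, hfx, hfy, iu, iv, ju, jv, iN, jN]
      · exact hnn
    simp only [Finset.sum_add_distrib, prodsum] at this
    linarith
  have htot : ∑ i, fu i + ∑ i, fv i + ∑ i, fx i + ∑ i, fy i = 1 := by
    rw [← hsum]
    simp only [← Finset.sum_add_distrib]
    exact Finset.sum_congr rfl fun z _ => (hsplit z).symm
  have := final_num (∑ i, fu i) (∑ i, fv i) (∑ i, fx i) (∑ i, fy i)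
    (Finset.sum_nonneg fun i _ => nfu i) (Finset.sum_nonneg fun i _ => nfv i)
    (Finset.sum_nonneg fun i _ => nfx i) (Finset.sum_nonneg fun i _ => nfy i) htot
    (lt_of_lt_of_le hG hGb)
  linarith

set_option maxHeartbeats 1000000 in
/-- The weighted theorem: edge density above one quarter. -/
theorem weighted_bound {G B : SimpleGraph V} (hc : CleanPair G B) (w : V → ℝ)
    (hw : ∀ v, 0 ≤ w v) (hsum : ∑ v, w v = 1) (hG : 1 / 2 < qf G w w) :
    qf B w w ≤ (2 - Real.sqrt 2) / 8 := by
  classical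
  induction hk : (Finset.univ.filter fun v => 0 < w v).card using Nat.strong_induction_on
    generalizing w with
  | _ k ih =>
  by_cases hno : ∀ a b c, 0 < w a → 0 < w b → 0 < w c → a ≠ b → a ≠ c → b ≠ c →
      ¬ G.Adj a b → ¬ G.Adj a c → G.Adj b c
  · -- terminal structure
    by_cases hb0 : ∃ u v, 0 < w u ∧ 0 < w v ∧ B.Adj u v
    swap
    · push Not at hb0
      have : qf B w w = 0 := by
        unfold qf
        refine Finset.sum_eq_zero fun i _ => Finset.sum_eq_zero fun j _ => ?_
        split_ifs with hij
        · rcases (hw i).eq_or_lt with hi | hi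
          · simp [← hi]
          rcases (hw j).eq_or_lt with hj | hj
          · simp [← hj]
          exact absurd hij (hb0 i j hi hj)
        · rfl
      rw [this]
      have : Real.sqrt 2 ≤ 2 := by
        rw [Real.sqrt_le_left (by norm_num)]; norm_num
      linarith
    obtain ⟨u, v, hu, hv, huv⟩ := hb0
    have htri : ∃ a b c, 0 < w a ∧ 0 < w b ∧ 0 < w c ∧ G.Adj a b ∧ G.Adj a c ∧ G.Adj b c := by
      by_contra hcon
      push Not at hcon
      have := mantel_weighted G w hw hsum (fun a b c ha hb hc' h1 h2 => hcon a b c ha hb hc' h1 h2)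
      linarith
    obtain ⟨a, b, c, ha, hb, hcc, hab, hac, hbc⟩ := htri
    have huvG := hc.le huv
    have huvne : u ≠ v := huvG.ne
    have tu : ∀ x y, G.Adj u x → G.Adj u y → ¬ G.Adj x y := fun x y => hc.tri u v x y huv
    have tv : ∀ x y, G.Adj v x → G.Adj v y → ¬ G.Adj x y := fun x y => hc.tri v u x y huv.symm
    have hM : ∃ m, 0 < w m ∧ m ≠ u ∧ m ≠ v ∧ ¬ G.Adj u m ∧ ¬ G.Adj v m := by
      have nau : a ≠ u := by rintro rfl; exact tu _ _ hab hac hbc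
      have nav : a ≠ v := by rintro rfl; exact tv _ _ hab hac hbc
      have nbu : b ≠ u := by rintro rfl; exact tu _ _ hab.symm hbc hac
      have nbv : b ≠ v := by rintro rfl; exact tv _ _ hab.symm hbc hac
      have ncu : c ≠ u := by rintro rfl; exact tu _ _ hac.symm hbc.symm hab
      have ncv : c ≠ v := by rintro rfl; exact tv _ _ hac.symm hbc.symm hab
      by_contra hcon
      push Not at hcon
      have ka := hcon a ha nau nav
      have kb := hcon b hb nbu nbv
      have kc := hcon c hcc ncu ncv
      by_cases ua : G.Adj u a
      · have vb := kb fun h => tu a b ua h hab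
        have vc := kc fun h => tu a c ua h hac
        exact tv b c vb vc hbc
      · have va := ka ua
        have ub : G.Adj u b := by
          by_contra h; exact tv a b va (kb h) hab
        have uc : G.Adj u c := by
          by_contra h; exact tv a c va (kc h) hac
        exact tu b c ub uc hbc
    obtain ⟨m, hm, mu, mv, num, nvm⟩ := hM
    by_cases h1 : ∀ z, 0 < w z → G.Adj v z → z = u
    · exact reduced_case hc w hw hsum hG hno u v huv hu hv h1 a b c ha hb hcc hab hac hbc
    by_cases h2 : ∀ z, 0 < w z → G.Adj u z → z = v
    · exact reduced_case hc w hw hsum hG hno v u huv.symm hv hu h2 a b c ha hb hcc hab hac hbc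
    exfalso
    push Not at h1 h2
    obtain ⟨y, hy, vy, yu⟩ := h1
    obtain ⟨x, hx, ux, xv⟩ := h2
    have uy : ¬ G.Adj u y := fun h => tv u y huvG.symm vy h
    have vx : ¬ G.Adj v x := fun h => tu v x huvG ux h
    have xm : G.Adj x m := hno v x m hv hx hm xv.symm mv.symm
      (by rintro rfl; exact num ux) vx nvm
    have my : G.Adj m y := hno u m y hu hm hy mu.symm yu.symm
      (by rintro rfl; exact nvm vy) num uy
    exact hc.five u v x m y huv ux xm my vy.symm
  · push Not at hno
    obtain ⟨a, b, c, ha, hb, hcc, hab, hac, hbc, nab, nac, nbc⟩ := hno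
    obtain ⟨x, y, z, hs, hD, hBB, wa, wb, wc, hz⟩ := move_three (w a) (w b) (w c)
      (qf G w (Pi.single a 1)) (qf G w (Pi.single b 1)) (qf G w (Pi.single c 1))
      (qf B w (Pi.single a 1)) (qf B w (Pi.single b 1)) (qf B w (Pi.single c 1)) ha hb hcc
    set d : V → ℝ := x • Pi.single a 1 + y • Pi.single b 1 + z • Pi.single c 1 with hd
    have eG := qf_move G w a b c nab nac nbc x y z
    have eB := qf_move B w a b c (fun h => nab (hc.le h)) (fun h => nac (hc.le h))
      (fun h => nbc (hc.le h)) x y z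
    simp only [← hd] at eG eB
    rw [hD] at eG
    have da : d a = x := by simp [hd, hab, hac, Pi.single_apply]
    have db : d b = y := by simp [hd, hab.symm, hbc, Pi.single_apply]
    have dc : d c = z := by simp [hd, hac.symm, hbc.symm, Pi.single_apply]
    have dz : ∀ t, t ≠ a → t ≠ b → t ≠ c → d t = 0 := by
      intro t h1 h2 h3; simp [hd, h1, h2, h3, Pi.single_apply]
    have hw' : ∀ t, 0 ≤ (w + d) t := by
      intro t
      by_cases h1 : t = a
      · subst h1; simpa [da] using wa
      by_cases h2 : t = b
      · subst h2; simpa [db] using wb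
      by_cases h3 : t = c
      · subst h3; simpa [dc] using wc
      simpa [dz t h1 h2 h3] using hw t
    have hdsum : ∑ t, d t = x + y + z := by
      simp [hd, Finset.sum_add_distrib, Pi.single_apply]
    have hsum' : ∑ t, (w + d) t = 1 := by
      rw [hs] at hdsum
      simp only [Pi.add_apply, Finset.sum_add_distrib, hsum, hdsum, add_zero]
    have hlt : (Finset.univ.filter fun t => 0 < (w + d) t).card < k := by
      rw [← hk]
      apply Finset.card_lt_card
      rw [Finset.ssubset_iff_of_subset]
      · rcases hz with h | h | h
        · exact ⟨a, by simpa using ha, by simp [da, h]⟩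
        · exact ⟨b, by simpa using hb, by simp [db, h]⟩
        · exact ⟨c, by simpa using hcc, by simp [dc, h]⟩
      · intro t ht
        simp only [Finset.mem_filter, Finset.mem_univ, true_and] at ht ⊢
        by_cases h1 : t = a
        · subst h1; exact ha
        by_cases h2 : t = b
        · subst h2; exact hb
        by_cases h3 : t = c
        · subst h3; exact hcc
        simpa [dz t h1 h2 h3] using ht
    have hfin := ih _ hlt (w + d) hw' hsum' (by rw [eG, mul_zero, add_zero]; exact hG) rfl
    rw [eB] at hfin
    refine le_trans ?_ hfin
    exact le_add_of_nonneg_right (mul_nonneg (by norm_num) hBB)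

end weighted

section counting
variable {V : Type*} [Fintype V]

open Classical in
/-- Number of ordered triangles. -/
noncomputable def ordTri (G : SimpleGraph V) : ℝ :=
  ∑ a, ∑ b, ∑ c, (if G.Adj a b ∧ G.Adj a c ∧ G.Adj b c then (1 : ℝ) else 0)

open Classical in
/-- Real-valued degree. -/
noncomputable def rdeg (G : SimpleGraph V) (a : V) : ℝ := ∑ b, if G.Adj a b then (1 : ℝ) else 0

lemma qf_one_one (G : SimpleGraph V) : qf G (fun _ => 1) (fun _ => 1) = ∑ a, rdeg G a := by
  simp [qf, rdeg]

lemma qf_one_single [DecidableEq V] (G : SimpleGraph V) (x : V) :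
    qf G (fun _ => 1) (Pi.single x 1) = rdeg G x := by
  classical
  rw [qf_comm]
  unfold qf rdeg
  rw [Finset.sum_eq_single x]
  · simp
  · intro b _ hb
    refine Finset.sum_eq_zero fun v _ => ?_
    simp [hb]
  · simp

lemma blue_edge_missing {G B : SimpleGraph V} (hc : CleanPair G B) {u v : V} (huv : B.Adj u v) :
    ∃ m : ℝ, 0 ≤ m ∧ rdeg G u + rdeg G v + m = Fintype.card V ∧
      ordTri G ≤ 3 * m ^ 2 * Fintype.card V := by
  classical
  have huvG := hc.le huv
  have tu : ∀ x y, G.Adj u x → G.Adj u y → ¬ G.Adj x y := fun x y => hc.tri u v x y huv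
  have tv : ∀ x y, G.Adj v x → G.Adj v y → ¬ G.Adj x y := fun x y => hc.tri v u x y huv.symm
  set f : V → ℝ := fun z => if ¬ G.Adj u z ∧ ¬ G.Adj v z then 1 else 0 with hf
  have nf : ∀ z, 0 ≤ f z := fun z => by simp only [hf]; split_ifs <;> simp
  refine ⟨∑ z, f z, Finset.sum_nonneg fun z _ => nf z, ?_, ?_⟩
  · have hcard : (Fintype.card V : ℝ) = ∑ _z : V, (1 : ℝ) := by simp
    rw [hcard]
    unfold rdeg
    simp only [← Finset.sum_add_distrib]
    refine Finset.sum_congr rfl fun z _ => ?_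
    have : G.Adj u z → ¬ G.Adj v z := fun h h' => tu v z huvG h h'
    simp only [hf]
    by_cases h1 : G.Adj u z
    · simp [h1, this h1]
    · by_cases h2 : G.Adj v z <;> simp [h1, h2]
  · have h1 : ordTri G ≤ ∑ a, ∑ b, ∑ c, (f a * f b * 1 + f a * 1 * f c + 1 * f b * f c) := by
      unfold ordTri
      refine Finset.sum_le_sum fun a _ => Finset.sum_le_sum fun b _ =>
        Finset.sum_le_sum fun c _ => ?_
      have nn : 0 ≤ f a * f b * 1 + f a * 1 * f c + 1 * f b * f c := by
        have := mul_nonneg (nf a) (nf b)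
        have := mul_nonneg (nf a) (nf c)
        have := mul_nonneg (nf b) (nf c)
        linarith
      split_ifs with h
      · obtain ⟨hab, hac, hbc⟩ := h
        -- at least two vertices are outside both neighbourhoods
        have key : ∀ x y, G.Adj x y → (∃ z, G.Adj x z ∧ G.Adj y z) →
            (¬ G.Adj u x ∧ ¬ G.Adj v x) ∨ (¬ G.Adj u y ∧ ¬ G.Adj v y) := by
          rintro x y hxy ⟨z, hxz, hyz⟩
          have h3 : G.Adj u x → G.Adj v y → False := fun h k =>
            hc.five u v x z y huv h hxz hyz.symm k.symm
          have h4 : G.Adj u y → G.Adj v x → False := fun h k =>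
            hc.five u v y z x huv h hyz hxz.symm k.symm
          by_cases ux : G.Adj u x
          · exact Or.inr ⟨fun h => tu x y ux h hxy, h3 ux⟩
          · by_cases vx : G.Adj v x
            · exact Or.inr ⟨fun h => h4 h vx, fun h => tv x y vx h hxy⟩
            · exact Or.inl ⟨ux, vx⟩
        have k1 := key a b hab ⟨c, hac, hbc⟩
        have k2 := key a c hac ⟨b, hab, hbc.symm⟩
        have k3 := key b c hbc ⟨a, hab.symm, hac.symm⟩
        have fone : ∀ z, (¬ G.Adj u z ∧ ¬ G.Adj v z) → f z = 1 := fun z hz => if_pos hz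
        have na := nf a
        have nb := nf b
        have nc := nf c
        rcases k1 with k1 | k1
        · rw [fone a k1]
          rcases k3 with k3 | k3
          · rw [fone b k3]; nlinarith
          · rw [fone c k3]; nlinarith
        · rw [fone b k1]
          rcases k2 with k2 | k2
          · rw [fone a k2]; nlinarith
          · rw [fone c k2]; nlinarith
      · exact nn
    refine h1.trans (le_of_eq ?_)
    simp only [Finset.sum_add_distrib, ← Finset.mul_sum, ← Finset.sum_mul, Finset.sum_const,
      Finset.card_univ, nsmul_eq_mul]
    ring

lemma num_a6 (t c : ℝ) (tpos : 0 < t) (t1 : t ≤ c / 2) (cpos : 0 < c) (c1 : c ≤ 1 / 128) :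
    t * t / 2 < (1 - t) * (1 + t) * (t * c) := by
  have h1 : (1 - t) * (1 + t) ≥ 1 / 2 := by nlinarith
  have h2 : 0 < t * c := mul_pos tpos cpos
  have h3 : 1 / 2 * (t * c) ≤ (1 - t) * (1 + t) * (t * c) := mul_le_mul_of_nonneg_right h1 h2.le
  nlinarith

set_option maxHeartbeats 1000000 in
theorem clean_bound (δ : ℝ) (hδ : 0 < δ) : ∃ η₀ : ℝ, 0 < η₀ ∧ ∃ K : ℝ, 0 < K ∧
    ∀ (n : ℕ) (G B : SimpleGraph (Fin n)) (η : ℝ), 0 < n → CleanPair G B →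
      δ * (n : ℝ) ^ 3 ≤ ordTri G → 0 < η → η ≤ η₀ →
      (1 / 2 - η) * (n : ℝ) ^ 2 ≤ qf G (fun _ => 1) (fun _ => 1) →
      qf B (fun _ => 1) (fun _ => 1) ≤ ((2 - Real.sqrt 2) / 8 + K * η) * (n : ℝ) ^ 2 := by
  classical
  set μ : ℝ := min 1 (δ / 3) with hμ
  have μpos : 0 < μ := lt_min one_pos (by positivity)
  have μ1 : μ ≤ 1 := min_le_left _ _
  have μδ : μ ≤ δ / 3 := min_le_right _ _
  set c : ℝ := μ / 128 with hcdef
  have cpos : 0 < c := by positivity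
  have c1 : c ≤ 1 / 128 := by rw [hcdef]; linarith
  refine ⟨c ^ 2 / 2, by positivity, 2 / c, by positivity, ?_⟩
  intro n G B η hn hc hT hη hη0 hG
  have hnR : (0 : ℝ) < n := by exact_mod_cast hn
  have hn2 : (0 : ℝ) < (n : ℝ) ^ 2 := by positivity
  have sq2 : Real.sqrt 2 ≤ 3 / 2 := by
    rw [Real.sqrt_le_left (by norm_num)]; norm_num
  by_cases hBsmall : qf B (fun _ => 1) (fun _ => 1) ≤ (2 - Real.sqrt 2) / 8 * (n : ℝ) ^ 2
  · refine hBsmall.trans ?_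
    apply mul_le_mul_of_nonneg_right _ hn2.le
    have : 0 < 2 / c * η := by positivity
    linarith
  push Not at hBsmall
  have hBbig : 1 / 16 * (n : ℝ) ^ 2 ≤ qf B (fun _ => 1) (fun _ => 1) := by nlinarith
  -- blue edges miss a lot
  have hmiss : ∀ u v, B.Adj u v → rdeg G u + rdeg G v ≤ (1 - μ) * n := by
    intro u v huv
    obtain ⟨m, hm, hsum, hT'⟩ := blue_edge_missing hc huv
    rw [Fintype.card_fin] at hsum hT'
    have h1 : δ * (n : ℝ) ^ 3 ≤ 3 * m ^ 2 * n := hT.trans hT'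
    have h2 : δ / 3 * (n : ℝ) ^ 2 ≤ m ^ 2 := by
      by_contra hcon
      push Not at hcon
      nlinarith
    have h3 : μ * n ≤ m := by
      apply (sq_le_sq₀ (by positivity) hm).mp
      refine le_trans ?_ h2
      rw [mul_pow]
      apply mul_le_mul_of_nonneg_right _ hn2.le
      nlinarith
    linarith
  -- a vertex of large degree
  have hx : ∃ x, (1 / 2 + c) * n ≤ rdeg G x := by
    by_contra hcon
    push Not at hcon
    set lo : Fin n → ℝ := fun z => if rdeg G z ≤ (1 - μ) / 2 * n then 1 else 0 with hlo
    have nlo : ∀ z, 0 ≤ lo z := fun z => by simp only [hlo]; split_ifs <;> simp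
    have hLo : qf B (fun _ => 1) (fun _ => 1) ≤ 2 * (∑ z, lo z) * n := by
      have : qf B (fun _ => 1) (fun _ => 1) ≤ ∑ u : Fin n, ∑ v : Fin n, (lo u + lo v) := by
        unfold qf
        refine Finset.sum_le_sum fun u _ => Finset.sum_le_sum fun v _ => ?_
        split_ifs with huv
        · have := hmiss u v huv
          rcases le_total (rdeg G u) (rdeg G v) with h | h
          · have : lo u = 1 := if_pos (by linarith)
            linarith [nlo v]
          · have : lo v = 1 := if_pos (by linarith)
            linarith [nlo u]
        · exact add_nonneg (nlo u) (nlo v)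
      refine this.trans (le_of_eq ?_)
      simp only [Finset.sum_add_distrib, Finset.sum_const, Finset.card_univ, Fintype.card_fin,
        nsmul_eq_mul, ← Finset.mul_sum]
      ring
    have hdeg : ∑ z, rdeg G z ≤ ∑ z : Fin n, ((1 / 2 + c) * n - lo z * (μ / 2 * n)) := by
      refine Finset.sum_le_sum fun z _ => ?_
      by_cases hz : rdeg G z ≤ (1 - μ) / 2 * n
      · have : lo z = 1 := if_pos hz
        rw [this]
        have := mul_pos cpos hnR
        linarith
      · have : lo z = 0 := if_neg hz
        rw [this]
        linarith [hcon z]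
    rw [← qf_one_one, Finset.sum_sub_distrib] at hdeg
    have hmul : ∑ z, lo z * (μ / 2 * n) = (∑ z, lo z) * (μ / 2 * n) := (Finset.sum_mul ..).symm
    rw [hmul] at hdeg
    simp only [Finset.sum_const, Finset.card_univ, Fintype.card_fin, nsmul_eq_mul] at hdeg
    have hLo2 : 1 / 32 * (n : ℝ) ≤ ∑ z, lo z := by
      by_contra hcon2
      push Not at hcon2
      nlinarith
    have h5 : 1 / 32 * (n : ℝ) * (μ / 2 * n) ≤ (∑ z, lo z) * (μ / 2 * n) :=
      mul_le_mul_of_nonneg_right hLo2 (by positivity)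
    have h6 : (1 / 2 - η) * (n : ℝ) ^ 2 ≤ (1 / 2 + c - μ / 64) * (n : ℝ) ^ 2 := by linarith
    have h7 := le_of_mul_le_mul_right h6 hn2
    have h8 : c ^ 2 / 2 < c := by nlinarith
    have h9 : μ / 64 = 2 * c := by rw [hcdef]; ring
    linarith
  obtain ⟨x, hx⟩ := hx
  set t : ℝ := η / c with ht
  have tpos : 0 < t := by positivity
  have htc : t * c = η := by rw [ht]; field_simp
  have t1 : t ≤ c / 2 := by
    rw [ht, div_le_iff₀ cpos]; nlinarith
  set ξ : ℝ := (1 - t) / n with hξ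
  have ξn : ξ * n = 1 - t := by rw [hξ]; field_simp
  have ξpos : 0 < ξ := by
    rw [hξ]; apply div_pos _ hnR; linarith
  set w : Fin n → ℝ := ξ • (fun _ => 1) + t • Pi.single x 1 with hwdef
  have hw : ∀ v, 0 ≤ w v := by
    intro v
    by_cases hv : v = x
    · subst hv; simp [hwdef]; linarith
    · simp [hwdef, hv]; linarith
  have hsum : ∑ v, w v = 1 := by
    simp [hwdef, Finset.sum_add_distrib, Pi.single_apply]
    linarith
  have expand : ∀ H : SimpleGraph (Fin n), qf H w w =
      ξ ^ 2 * qf H (fun _ => 1) (fun _ => 1) + 2 * ξ * t * rdeg H x := by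
    intro H
    rw [hwdef, qf_add_left, qf_add_right, qf_add_right]
    simp only [qf_smul_left, qf_smul_right]
    rw [qf_single_single H x x H.irrefl, qf_comm H (Pi.single x 1), qf_one_single]
    ring
  have hGw : 1 / 2 < qf G w w := by
    rw [expand]
    have a1 : ξ ^ 2 * ((1 / 2 - η) * (n : ℝ) ^ 2) ≤ ξ ^ 2 * qf G (fun _ => 1) (fun _ => 1) :=
      mul_le_mul_of_nonneg_left hG (by positivity)
    have a2 : 2 * ξ * t * ((1 / 2 + c) * n) ≤ 2 * ξ * t * rdeg G x :=
      mul_le_mul_of_nonneg_left hx (by positivity)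
    have a3 : ξ ^ 2 * ((1 / 2 - η) * (n : ℝ) ^ 2) = (1 - t) ^ 2 * (1 / 2 - η) := by
      rw [← ξn]; ring
    have a4 : 2 * ξ * t * ((1 / 2 + c) * n) = 2 * (1 - t) * t * (1 / 2 + c) := by
      rw [← ξn]; ring
    have a5 : (1 - t) ^ 2 * (1 / 2 - η) + 2 * (1 - t) * t * (1 / 2 + c)
        = 1 / 2 + ((1 - t) * (1 + t) * (t * c) - t * t / 2) := by rw [← htc]; ring
    have a6 : t * t / 2 < (1 - t) * (1 + t) * (t * c) := by
      exact num_a6 t c tpos t1 cpos c1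
    linarith
  have hfin := weighted_bound hc w hw hsum hGw
  rw [expand] at hfin
  have hdB : 0 ≤ rdeg B x := by
    unfold rdeg
    exact Finset.sum_nonneg fun b _ => by split_ifs <;> simp
  have hb1 : ξ ^ 2 * qf B (fun _ => 1) (fun _ => 1) ≤ (2 - Real.sqrt 2) / 8 := by
    have : 0 ≤ 2 * ξ * t * rdeg B x := by positivity
    linarith
  set b := qf B (fun _ => 1) (fun _ => 1) with hb
  have hbn : b ≤ (n : ℝ) ^ 2 := by
    have : b ≤ ∑ _u : Fin n, ∑ _v : Fin n, (1 : ℝ) := by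
      rw [hb]; unfold qf
      refine Finset.sum_le_sum fun u _ => Finset.sum_le_sum fun v _ => ?_
      split_ifs <;> simp
    simpa [sq] using this
  have hb2 : (1 - t) ^ 2 * b ≤ (2 - Real.sqrt 2) / 8 * (n : ℝ) ^ 2 := by
    have := mul_le_mul_of_nonneg_right hb1 hn2.le
    calc (1 - t) ^ 2 * b = ξ ^ 2 * b * (n : ℝ) ^ 2 := by rw [← ξn]; ring
      _ ≤ _ := this
  have hK : 2 / c * η = 2 * t := by rw [ht]; ring
  have hbpos : 0 ≤ b := by linarith [hBbig]
  rw [hK]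
  have q1 := mul_nonneg hbpos (sq_nonneg t)
  have q2 := mul_le_mul_of_nonneg_left hbn tpos.le
  linarith

end counting

section cleaning
variable {V : Type*} [Fintype V]

/-- No blue edge lies on a genuine five-cycle. -/
def NoFive (G B : SimpleGraph V) : Prop :=
  ∀ u v x y z, B.Adj u v → G.Adj u x → G.Adj x y → G.Adj y z → G.Adj z v →
    x ≠ v → z ≠ u → x ≠ z → y ≠ u → y ≠ v → False

/-- A triangle edge at a vertex of large blue degree. -/
def isBad (G B : SimpleGraph V) (h : ℝ) (a b : V) : Prop :=
  h + 2 ≤ rdeg B a ∧ G.Adj a b ∧ ∃ c, G.Adj a c ∧ G.Adj b c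

/-- Remove all bad edges. -/
def cleanG (G B : SimpleGraph V) (h : ℝ) : SimpleGraph V where
  Adj a b := G.Adj a b ∧ ¬ isBad G B h a b ∧ ¬ isBad G B h b a
  symm := ⟨fun _ _ hab => ⟨hab.1.symm, hab.2.2, hab.2.1⟩⟩
  loopless := ⟨fun _ ha => G.irrefl ha.1⟩

/-- Remove bad edges and blue edges at vertices of small blue degree. -/
def cleanB (G B : SimpleGraph V) (h : ℝ) : SimpleGraph V where
  Adj a b := B.Adj a b ∧ (cleanG G B h).Adj a b ∧ h + 2 ≤ rdeg B a ∧ h + 2 ≤ rdeg B b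
  symm := ⟨fun _ _ hab => ⟨hab.1.symm, hab.2.1.symm, hab.2.2.2, hab.2.2.1⟩⟩
  loopless := ⟨fun _ ha => B.irrefl ha.1⟩

lemma cleanPair_clean (G B : SimpleGraph V) (h : ℝ) (h5 : NoFive G B) :
    CleanPair (cleanG G B h) (cleanB G B h) := by
  have htri : ∀ u a b, h + 2 ≤ rdeg B u → (cleanG G B h).Adj u a → (cleanG G B h).Adj u b →
      ¬ (cleanG G B h).Adj a b := by
    intro u a b hu ua ub ab
    exact ua.2.1 ⟨hu, ua.1, b, ub.1, ab.1⟩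
  refine ⟨fun a b hab => hab.2.1, fun u v a b huv => htri u a b huv.2.2.1, ?_⟩
  intro u v x y z huv ux xy yz zv
  have tu := fun a b => htri u a b huv.2.2.1
  have tv := fun a b => htri v a b huv.2.2.2
  have uv := huv.2.1
  by_cases h1 : x = v
  · subst h1; exact tv y z xy zv.symm yz
  by_cases h2 : z = u
  · subst h2; exact tu x y ux yz.symm xy
  by_cases h3 : x = z
  · subst h3; exact tu x v ux uv zv
  by_cases h4 : y = u
  · subst h4; exact tu z v yz uv zv
  by_cases h6 : y = v
  · subst h6; exact tu x y ux uv xy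
  exact h5 u v x y z huv.1 ux.1 xy.1 yz.1 zv.1 h1 h2 h3 h4 h6

open Classical in
lemma bad_count (G B : SimpleGraph V) (h : ℝ) (h5 : NoFive G B) (hBG : B ≤ G) :
    (∑ a, ∑ b, if isBad G B h a b then (1 : ℝ) else 0) * h ≤ 2 * (Fintype.card V : ℝ) ^ 2 := by
  set P : V → V → V → Prop := fun a b v => B.Adj v a ∧ v ≠ b ∧ G.Adj a b ∧
    ∃ c, c ≠ v ∧ G.Adj a c ∧ G.Adj b c with hP
  have k1 : ∀ a b, (if isBad G B h a b then (1 : ℝ) else 0) * h ≤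
      ∑ v, if P a b v then (1 : ℝ) else 0 := by
    intro a b
    split_ifs with hab
    · obtain ⟨hd, ab, c, ac, bc⟩ := hab
      have : rdeg B a ≤ ∑ v, ((if P a b v then (1 : ℝ) else 0) + (if v = b then 1 else 0)
          + (if v = c then 1 else 0)) := by
        unfold rdeg
        refine Finset.sum_le_sum fun v _ => ?_
        have n1 : (0 : ℝ) ≤ if P a b v then (1 : ℝ) else 0 := by split_ifs <;> simp
        have n2 : (0 : ℝ) ≤ if v = b then (1 : ℝ) else 0 := by split_ifs <;> simp
        have n3 : (0 : ℝ) ≤ if v = c then (1 : ℝ) else 0 := by split_ifs <;> simp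
        by_cases av : B.Adj a v
        · rw [if_pos av]
          by_cases vb : v = b
          · rw [if_pos vb] at n2 ⊢; linarith
          by_cases vc : v = c
          · rw [if_pos vc] at n3 ⊢; linarith
          have : P a b v := ⟨av.symm, vb, ab, c, Ne.symm vc, ac, bc⟩
          rw [if_pos this] at n1 ⊢
          linarith
        · rw [if_neg av]; linarith
      simp only [Finset.sum_add_distrib, Finset.sum_ite_eq', Finset.mem_univ, if_true] at this
      linarith
    · rw [zero_mul]
      exact Finset.sum_nonneg fun v _ => by split_ifs <;> simp
  have k2 : ∀ b v, (∑ a, if P a b v then (1 : ℝ) else 0) ≤ 2 := by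
    intro b v
    by_cases hex : ∃ a, P a b v
    · obtain ⟨a0, va0, vb, a0b, c0, c0v, a0c0, bc0⟩ := hex
      have : (∑ a, if P a b v then (1 : ℝ) else 0) ≤
          ∑ a, ((if a = a0 then (1 : ℝ) else 0) + (if a = c0 then 1 else 0)) := by
        refine Finset.sum_le_sum fun a _ => ?_
        by_cases e1 : a = a0
        · rw [if_pos e1]
          split_ifs <;> norm_num
        by_cases e2 : a = c0
        · rw [if_pos e2]
          split_ifs <;> norm_num
        have : ¬ P a b v := by
          rintro ⟨va, -, ab, -⟩
          exact h5 v a0 a b c0 va0 (hBG va) ab bc0 a0c0.symm e1 c0v e2 (Ne.symm vb) a0b.ne.symm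
        rw [if_neg this, if_neg e1, if_neg e2]; norm_num
      simp only [Finset.sum_add_distrib, Finset.sum_ite_eq', Finset.mem_univ, if_true] at this
      linarith
    · push Not at hex
      rw [Finset.sum_eq_zero]
      · norm_num
      · intro a _; exact if_neg (hex a)
  calc (∑ a, ∑ b, if isBad G B h a b then (1 : ℝ) else 0) * h
      = ∑ a, ∑ b, (if isBad G B h a b then (1 : ℝ) else 0) * h := by
        simp only [Finset.sum_mul]
    _ ≤ ∑ a, ∑ b, ∑ v, (if P a b v then (1 : ℝ) else 0) :=
        Finset.sum_le_sum fun a _ => Finset.sum_le_sum fun b _ => k1 a b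
    _ = ∑ b, ∑ v, ∑ a, (if P a b v then (1 : ℝ) else 0) := by
        rw [Finset.sum_comm]
        refine Finset.sum_congr rfl fun b _ => ?_
        rw [Finset.sum_comm]
    _ ≤ ∑ _b : V, ∑ _v : V, (2 : ℝ) :=
        Finset.sum_le_sum fun b _ => Finset.sum_le_sum fun v _ => k2 b v
    _ = 2 * (Fintype.card V : ℝ) ^ 2 := by
        simp only [Finset.sum_const, Finset.card_univ, nsmul_eq_mul]; ring

open Classical in
lemma cleanG_loss (G B : SimpleGraph V) (h : ℝ) (hh : 0 < h) (h5 : NoFive G B) (hBG : B ≤ G) :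
    qf G (fun _ => 1) (fun _ => 1) ≤ qf (cleanG G B h) (fun _ => 1) (fun _ => 1)
      + 4 * (Fintype.card V : ℝ) ^ 2 / h := by
  have hb := bad_count G B h h5 hBG
  set S := ∑ a, ∑ b, if isBad G B h a b then (1 : ℝ) else 0 with hS
  have h1 : S ≤ 2 * (Fintype.card V : ℝ) ^ 2 / h := by rwa [le_div_iff₀ hh]
  have h2 : qf G (fun _ => 1) (fun _ => 1) ≤ qf (cleanG G B h) (fun _ => 1) (fun _ => 1)
      + S + S := by
    have hS2 : S = ∑ a, ∑ b, if isBad G B h b a then (1 : ℝ) else 0 := by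
      rw [hS, Finset.sum_comm]
    nth_rw 2 [hS2]
    rw [hS]
    unfold qf
    simp only [← Finset.sum_add_distrib]
    refine Finset.sum_le_sum fun a _ => Finset.sum_le_sum fun b _ => ?_
    by_cases p1 : isBad G B h a b
    · rw [if_pos p1]; split_ifs <;> norm_num
    by_cases p2 : isBad G B h b a
    · rw [if_pos p2]; split_ifs <;> norm_num
    by_cases p3 : G.Adj a b
    · have : (cleanG G B h).Adj a b := ⟨p3, p1, p2⟩
      simp [p1, p2, p3, this]
    · rw [if_neg p3]; split_ifs <;> norm_num
  have h3 : 4 * (Fintype.card V : ℝ) ^ 2 / h = 2 * (2 * (Fintype.card V : ℝ) ^ 2 / h) := by ring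
  linarith

open Classical in
lemma cleanB_loss (G B : SimpleGraph V) (h : ℝ) (hh : 0 < h) (hBG : B ≤ G) :
    qf B (fun _ => 1) (fun _ => 1) ≤ qf (cleanB G B h) (fun _ => 1) (fun _ => 1)
      + (qf G (fun _ => 1) (fun _ => 1) - qf (cleanG G B h) (fun _ => 1) (fun _ => 1))
      + 2 * (Fintype.card V : ℝ) * (h + 2) := by
  set lo : V → V → ℝ := fun a b => if B.Adj a b ∧ ¬ h + 2 ≤ rdeg B a then 1 else 0 with hlo
  have nlo : ∀ a b, 0 ≤ lo a b := fun a b => by simp only [hlo]; split_ifs <;> simp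
  have hL : ∑ a, ∑ b, lo a b ≤ (Fintype.card V : ℝ) * (h + 2) := by
    have : ∑ a, ∑ b, lo a b ≤ ∑ _a : V, (h + 2) := by
      refine Finset.sum_le_sum fun a _ => ?_
      by_cases ha : h + 2 ≤ rdeg B a
      · simp only [hlo, ha]; simp; linarith
      · simp only [hlo, ha]
        simp only [not_false_eq_true, and_true]
        push Not at ha
        exact ha.le
    simpa only [Finset.sum_const, Finset.card_univ, nsmul_eq_mul] using this
  have hL2 : ∑ a, ∑ b, lo b a = ∑ a, ∑ b, lo a b := Finset.sum_comm
  have : qf B (fun _ => 1) (fun _ => 1) + qf (cleanG G B h) (fun _ => 1) (fun _ => 1)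
      ≤ qf (cleanB G B h) (fun _ => 1) (fun _ => 1) + qf G (fun _ => 1) (fun _ => 1)
        + ∑ a, ∑ b, lo a b + ∑ a, ∑ b, lo b a := by
    unfold qf
    simp only [← Finset.sum_add_distrib]
    refine Finset.sum_le_sum fun a _ => Finset.sum_le_sum fun b _ => ?_
    have n1 := nlo a b
    have n2 := nlo b a
    have n3 : (0 : ℝ) ≤ if (cleanB G B h).Adj a b then (1 : ℝ) * 1 else 0 := by
      split_ifs <;> norm_num
    by_cases p1 : B.Adj a b
    · rw [if_pos p1, if_pos (hBG p1)]
      by_cases p2 : (cleanG G B h).Adj a b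
      · rw [if_pos p2]
        by_cases p3 : h + 2 ≤ rdeg B a
        · by_cases p4 : h + 2 ≤ rdeg B b
          · rw [if_pos (show (cleanB G B h).Adj a b from ⟨p1, p2, p3, p4⟩)]
            linarith
          · have : lo b a = 1 := if_pos ⟨p1.symm, p4⟩
            linarith
        · have : lo a b = 1 := if_pos ⟨p1, p3⟩
          linarith
      · rw [if_neg p2]; linarith
    · rw [if_neg p1]
      by_cases p2 : (cleanG G B h).Adj a b
      · rw [if_pos p2, if_pos p2.1]; linarith
      · rw [if_neg p2]
        have : (0 : ℝ) ≤ if G.Adj a b then (1 : ℝ) * 1 else 0 := by split_ifs <;> norm_num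
        linarith
  linarith

open Classical in
lemma ordTri_loss (G H : SimpleGraph V) (hHG : H ≤ G) :
    ordTri G ≤ ordTri H + 3 * (Fintype.card V : ℝ) *
      (qf G (fun _ => 1) (fun _ => 1) - qf H (fun _ => 1) (fun _ => 1)) := by
  set D : V → V → ℝ := fun a b => if G.Adj a b ∧ ¬ H.Adj a b then 1 else 0 with hD
  have nD : ∀ a b, 0 ≤ D a b := fun a b => by simp only [hD]; split_ifs <;> simp
  have hq : qf G (fun _ => 1) (fun _ => 1) - qf H (fun _ => 1) (fun _ => 1) = ∑ a, ∑ b, D a b := by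
    unfold qf
    simp only [← Finset.sum_sub_distrib]
    refine Finset.sum_congr rfl fun a _ => Finset.sum_congr rfl fun b _ => ?_
    simp only [hD]
    by_cases p : H.Adj a b
    · simp [p, hHG p]
    · simp [p]
  have h1 : ordTri G ≤ ordTri H + ((∑ a, ∑ b, ∑ _c : V, D a b) + (∑ a, ∑ _b : V, ∑ c, D a c)
      + ∑ _a : V, ∑ b, ∑ c, D b c) := by
    unfold ordTri
    simp only [← Finset.sum_add_distrib]
    refine Finset.sum_le_sum fun a _ => Finset.sum_le_sum fun b _ =>
      Finset.sum_le_sum fun c _ => ?_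
    have n1 := nD a b
    have n2 := nD a c
    have n3 := nD b c
    by_cases hg : G.Adj a b ∧ G.Adj a c ∧ G.Adj b c
    · rw [if_pos hg]
      obtain ⟨g1, g2, g3⟩ := hg
      have n4 : (0 : ℝ) ≤ if H.Adj a b ∧ H.Adj a c ∧ H.Adj b c then (1 : ℝ) else 0 := by
        split_ifs <;> norm_num
      by_cases p1 : H.Adj a b
      · by_cases p2 : H.Adj a c
        · by_cases p3 : H.Adj b c
          · rw [if_pos ⟨p1, p2, p3⟩]; linarith
          · have : D b c = 1 := if_pos ⟨g3, p3⟩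
            linarith
        · have : D a c = 1 := if_pos ⟨g2, p2⟩
          linarith
      · have : D a b = 1 := if_pos ⟨g1, p1⟩
        linarith
    · rw [if_neg hg]
      have n4 : (0 : ℝ) ≤ if H.Adj a b ∧ H.Adj a c ∧ H.Adj b c then (1 : ℝ) else 0 := by
        split_ifs <;> norm_num
      linarith
  rw [hq]
  refine h1.trans (le_of_eq ?_)
  simp only [Finset.sum_const, Finset.card_univ, nsmul_eq_mul, ← Finset.mul_sum]
  ring

end cleaning

section assembly

lemma occurs_five {V : Type*} (G : SimpleGraph V) (u v x y z : V) (uv : G.Adj u v)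
    (ux : G.Adj u x) (xy : G.Adj x y) (yz : G.Adj y z) (zv : G.Adj z v)
    (h1 : x ≠ v) (h2 : z ≠ u) (h3 : x ≠ z) (h4 : y ≠ u) (h5 : y ≠ v) :
    occursInC G 5 s(u, v) := by
  refine ⟨u, Walk.cons ux (Walk.cons xy (Walk.cons yz (Walk.cons zv
    (Walk.cons uv.symm Walk.nil)))), ?_, by simp, by simp [Sym2.eq_swap]⟩
  rw [Walk.cons_isCycle_iff]
  have a1 := ux.ne
  have a2 := xy.ne
  have a3 := yz.ne
  have a4 := zv.ne
  have a5 := uv.ne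
  constructor
  · simp [Walk.cons_isPath_iff, a1.symm, a2, a3, a4, a5.symm, h1, h2, h3, h4, h5]
  · simp [a1, a1.symm, a2, a3, a4, a5, a5.symm, h1, h2, h2.symm, h3, h4, h4.symm, h5]

lemma qf_eq_edges {n : ℕ} (H : SimpleGraph (Fin n)) :
    qf H (fun _ => 1) (fun _ => 1) = 2 * (H.edgeSet.ncard : ℝ) := by
  classical
  rw [qf_one_one]
  have h1 : ∀ a, rdeg H a = (H.degree a : ℝ) := by
    intro a
    unfold rdeg
    rw [Finset.sum_boole]
    congr 1
    rw [← SimpleGraph.card_neighborFinset_eq_degree]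
    congr 1
    ext b
    simp
  simp only [h1]
  have h2 := H.sum_degrees_eq_twice_card_edges
  have h3 : H.edgeSet.ncard = H.edgeFinset.card := by
    rw [← SimpleGraph.coe_edgeFinset, Set.ncard_coe_finset]
  rw [h3]
  exact_mod_cast h2

lemma triangleCount_le {n : ℕ} (G : SimpleGraph (Fin n)) : (triangleCount G : ℝ) ≤ ordTri G := by
  classical
  set T : Finset (Fin n × Fin n × Fin n) := Finset.univ.filter fun p =>
    G.Adj p.1 p.2.1 ∧ G.Adj p.1 p.2.2 ∧ G.Adj p.2.1 p.2.2 with hT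
  have h1 : ordTri G = (T.card : ℝ) := by
    rw [hT, Finset.card_filter, Nat.cast_sum, Fintype.sum_prod_type]
    unfold ordTri
    refine Finset.sum_congr rfl fun a _ => ?_
    rw [Fintype.sum_prod_type]
    refine Finset.sum_congr rfl fun b _ => Finset.sum_congr rfl fun c _ => ?_
    simp
  rw [h1]
  have h2 : {t : Finset (Fin n) | G.IsNClique 3 t} ⊆
      ((T.image fun p => ({p.1, p.2.1, p.2.2} : Finset (Fin n))) : Set (Finset (Fin n))) := by
    intro t ht
    obtain ⟨a, b, c, hab, hac, hbc, rfl⟩ := SimpleGraph.is3Clique_iff.mp ht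
    rw [Finset.mem_coe, Finset.mem_image]
    exact ⟨(a, b, c), by simp [hT, hab, hac, hbc], rfl⟩
  have h3 := Set.ncard_le_ncard h2 (Finset.finite_toSet _)
  rw [Set.ncard_coe_finset] at h3
  exact_mod_cast h3.trans Finset.card_image_le

theorem blue_bound (δ : ℝ) (hδ : 0 < δ) : ∃ m : ℝ, 0 < m ∧ ∃ K : ℝ, 0 < K ∧
    ∀ (n : ℕ) (G B : SimpleGraph (Fin n)) (h : ℝ), 1 ≤ h → h ^ 8 = n → B ≤ G → NoFive G B →
      δ * (n : ℝ) ^ 3 ≤ ordTri G → 4 / h ≤ m →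
      1 / 2 * (n : ℝ) ^ 2 ≤ qf G (fun _ => 1) (fun _ => 1) →
      qf B (fun _ => 1) (fun _ => 1) ≤ (2 - Real.sqrt 2) / 8 * (n : ℝ) ^ 2 + K * h ^ 15 := by
  obtain ⟨η₀, hη₀, K, hK, hmain⟩ := clean_bound (δ / 2) (by positivity)
  refine ⟨min η₀ (δ / 6), lt_min hη₀ (by positivity), 4 * K + 10, by positivity, ?_⟩
  intro n G B h h1 hn hBG h5 hT hm hG
  have hpos : 0 < h := by linarith
  have hnR : (0 : ℝ) < n := by rw [← hn]; positivity
  have hn0 : 0 < n := by exact_mod_cast hnR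
  have hη : 0 < 4 / h := by positivity
  have hm1 : 4 / h ≤ η₀ := hm.trans (min_le_left _ _)
  have hm2 : 4 / h ≤ δ / 6 := hm.trans (min_le_right _ _)
  have hn2 : (n : ℝ) ^ 2 = h ^ 15 * h := by rw [← hn]; ring
  have e1 : 4 * (n : ℝ) ^ 2 / h = 4 / h * (n : ℝ) ^ 2 := by ring
  have e2 : 4 / h * (n : ℝ) ^ 2 = 4 * h ^ 15 := by rw [hn2]; field_simp
  have l1 := cleanG_loss G B h hpos h5 hBG
  have l2 := cleanB_loss G B h hpos hBG
  have hle : cleanG G B h ≤ G := fun a b hab => hab.1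
  have l3 := ordTri_loss G (cleanG G B h) hle
  rw [Fintype.card_fin] at l1 l2 l3
  rw [e1] at l1
  have t1 : δ / 2 * (n : ℝ) ^ 3 ≤ ordTri (cleanG G B h) := by
    have q1 : qf G (fun _ => 1) (fun _ => 1) - qf (cleanG G B h) (fun _ => 1) (fun _ => 1)
        ≤ δ / 6 * (n : ℝ) ^ 2 := by
      have := mul_le_mul_of_nonneg_right hm2 (sq_nonneg (n : ℝ))
      linarith
    have q2 := mul_le_mul_of_nonneg_left q1 (show (0 : ℝ) ≤ 3 * n by positivity)
    have q3 : 3 * (n : ℝ) * (δ / 6 * (n : ℝ) ^ 2) = δ / 2 * (n : ℝ) ^ 3 := by ring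
    linarith
  have t2 := hmain n (cleanG G B h) (cleanB G B h) (4 / h) hn0 (cleanPair_clean G B h h5) t1 hη hm1
    (by linarith)
  have p1 : h ^ 9 ≤ h ^ 15 := pow_le_pow_right₀ h1 (by norm_num)
  have p2 : h ^ 8 ≤ h ^ 15 := pow_le_pow_right₀ h1 (by norm_num)
  have e3 : 2 * (n : ℝ) * (h + 2) = 2 * h ^ 9 + 4 * h ^ 8 := by rw [← hn]; ring
  have e4 : ((2 - Real.sqrt 2) / 8 + K * (4 / h)) * (n : ℝ) ^ 2
      = (2 - Real.sqrt 2) / 8 * (n : ℝ) ^ 2 + K * (4 / h * (n : ℝ) ^ 2) := by ring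
  rw [e4, e2] at t2
  rw [e2] at l1
  rw [e3] at l2
  linarith

end assembly

theorem stmt8 :
    ∀ δ : ℝ, 0 < δ → ∃ C : ℝ, 0 < C ∧ ∀ n : ℕ, ∀ G : SimpleGraph (Fin n),
      ∀ R B : Set (Sym2 (Fin n)),
        G.edgeSet.ncard = n ^ 2 / 4 + 1 →
        δ * (n : ℝ) ^ 3 ≤ (triangleCount G : ℝ) →
        R ∪ B = G.edgeSet → Disjoint R B →
        (∀ e ∈ B, ¬ occursInC G 5 e) →
        ((2 + Real.sqrt 2) / 16) * (n : ℝ) ^ 2 - C * (n : ℝ) ^ ((15 : ℝ) / 8)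
          ≤ (R.ncard : ℝ) := by
  intro δ hδ
  obtain ⟨m, hm, K, hK, hmain⟩ := blue_bound δ hδ
  refine ⟨4 / m + K, by positivity, ?_⟩
  intro n G R B hE hT hRB hdisj hno
  have hR0 : (0 : ℝ) ≤ R.ncard := Nat.cast_nonneg _
  rcases Nat.eq_zero_or_pos n with rfl | hn
  · have : ((0 : ℕ) : ℝ) ^ ((15 : ℝ) / 8) = 0 := by
      rw [Nat.cast_zero, Real.zero_rpow (by norm_num)]
    rw [this]; simp
  have hn1 : (1 : ℝ) ≤ n := by exact_mod_cast hn
  have hn0 : (0 : ℝ) ≤ n := by linarith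
  set h : ℝ := (n : ℝ) ^ ((1 : ℝ) / 8) with hh
  have h1 : 1 ≤ h := Real.one_le_rpow hn1 (by norm_num)
  have hpos : 0 < h := by linarith
  have h8 : h ^ 8 = n := by
    rw [hh, ← Real.rpow_natCast, ← Real.rpow_mul hn0]; norm_num
  have h15 : (n : ℝ) ^ ((15 : ℝ) / 8) = h ^ 15 := by
    rw [hh, ← Real.rpow_natCast, ← Real.rpow_mul hn0]; norm_num
  rw [h15]
  have hn2 : (n : ℝ) ^ 2 = h ^ 15 * h := by rw [← h8]; ring
  have h15p : 0 < h ^ 15 := by positivity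
  by_cases hsm : 4 / h ≤ m
  · set Bg : SimpleGraph (Fin n) := SimpleGraph.fromEdgeSet B with hBg
    have hBsub : B ⊆ G.edgeSet := by rw [← hRB]; exact Set.subset_union_right
    have hBE : Bg.edgeSet = B := by
      rw [hBg, SimpleGraph.edgeSet_fromEdgeSet]
      ext e
      refine ⟨fun he => he.1, fun he => ⟨he, ?_⟩⟩
      exact G.not_isDiag_of_mem_edgeSet (hBsub he)
    have hle : Bg ≤ G := by
      rw [← SimpleGraph.edgeSet_subset_edgeSet, hBE]; exact hBsub
    have h5 : NoFive G Bg := by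
      intro u v x y z uv ux xy yz zv a1 a2 a3 a4 a5
      have huvB : s(u, v) ∈ B := by rw [← hBE]; exact uv
      exact hno _ huvB (occurs_five G u v x y z (hle uv) ux xy yz zv a1 a2 a3 a4 a5)
    have hEr : (n : ℝ) ^ 2 / 4 ≤ (G.edgeSet.ncard : ℝ) := by
      have : n ^ 2 ≤ 4 * G.edgeSet.ncard := by rw [hE]; omega
      have : (n : ℝ) ^ 2 ≤ 4 * (G.edgeSet.ncard : ℝ) := by exact_mod_cast this
      linarith
    have hq := qf_eq_edges G
    have hqB := qf_eq_edges Bg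
    rw [hBE] at hqB
    have hb := hmain n G Bg h h1 h8 hle h5 (hT.trans (triangleCount_le G)) hsm (by linarith)
    have hcard : (G.edgeSet.ncard : ℝ) = R.ncard + B.ncard := by
      rw [← hRB, Set.ncard_union_eq hdisj (Set.toFinite _) (Set.toFinite _)]
      push_cast; rfl
    have hx : 0 < 4 / m * h ^ 15 := by positivity
    have hy : 0 < K * h ^ 15 := by positivity
    linarith
  · push Not at hsm
    have hs2 : Real.sqrt 2 ≤ 2 := by
      rw [Real.sqrt_le_left (by norm_num)]; norm_num
    have : h ≤ 4 / m := by
      rw [le_div_iff₀ hm]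
      rw [lt_div_iff₀ hpos] at hsm
      linarith
    have q1 := mul_le_mul_of_nonneg_left this h15p.le
    have hy : 0 < K * h ^ 15 := by positivity
    have q2 : (2 + Real.sqrt 2) / 16 * (n : ℝ) ^ 2 ≤ 1 * (n : ℝ) ^ 2 :=
      mul_le_mul_of_nonneg_right (by linarith) (sq_nonneg _)
    linarith
end
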